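/- Let n ≥ 2, 0 ≤ s ≤ 1/2, γ > 0, σ > 0, ε > 0, R0 > 0, and suppose 1 + σ − 2s ≠ min{α, 1}. Let F ∈ C¹(B_{R0}; ℝ^{n−1}) with ‖F‖_{ε,σ,s,B_{R0}} < ∞, G ∈ C(B_{R0}) with ‖G‖_{ε,σ−1,s,B_{R0}} < ∞, and let v̄ ∈ C²(B_{R0}) ∩ C(closure B_{R0}) satisfy (ε + |y|²) Δv̄(y) + 2⟨y, ∇v̄(y)⟩ − (2/γ) v̄(y) = div F(y) + G(y) for all y ∈ B_{R0} ⊂ ℝ^{n−1}. Then there exists C > 0, depending only on n, σ, s, γ, R0 (in particular independent of ε), such that for every R ∈ (0, R0/2), ( ⨍_{∂B_R} |v̄ − (v̄)_{∂B_R}|² )^{1/2} ≤ C ( ‖F‖_{ε,σ,s,B_{R0}} + ‖G‖_{ε,σ−1,s,B_{R0}} + ( ⨍_{∂B_{R0}} |v̄ − (v̄)_{∂B_{R0}}|² )^{1/2} ) · R^{α̃}, where α̃ := min{α, 1, 1 + σ − 2s}. -/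

import Mathlib

open MeasureTheory Metric Set
open scoped RealInnerProductSpace ENNReal

noncomputable section

abbrev E (k : ℕ) := EuclideanSpace ℝ (Fin k)

/-- Laplacian: sum of pure second directional derivatives. -/
def elap {k : ℕ} (u : E k → ℝ) (x : E k) : ℝ :=
  ∑ i : Fin k, iteratedFDeriv ℝ 2 u x ![EuclideanSpace.single i 1, EuclideanSpace.single i 1]

/-- Average of `w` over the sphere `∂B_ρ ⊂ ℝ^m`, with respect to
`(m-1)`-dimensional Hausdorff measure. -/
def sAvg {m : ℕ} (ρ : ℝ) (w : E m → ℝ) : ℝ :=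
  ⨍ x in sphere (0 : E m) ρ, w x ∂(μH[(m:ℝ) - 1])

/-- The mean-square deviation `( ⨍_{∂B_ρ} |w - (w)_{∂B_ρ}|² )^{1/2}`. -/
def sDev {m : ℕ} (ρ : ℝ) (w : E m → ℝ) : ℝ :=
  Real.sqrt (⨍ x in sphere (0 : E m) ρ, (w x - sAvg ρ w)^2 ∂(μH[(m:ℝ) - 1]))

/-- Divergence of a vector field on `ℝ^m`. -/
def divg {m : ℕ} (F : E m → E m) (y : E m) : ℝ :=
  ∑ i : Fin m, (fderiv ℝ F y (EuclideanSpace.single i 1)) i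

section
open Filter Topology

/-- Maximum principle on `(0, ρ]` for a function with a possibly discontinuous perturbation `e`
of the flux relation `Z' = J / ω + e`. -/
theorem le_max_add_of_flux {ρ : ℝ} {Z Z' J J' ω Θ θ : ℝ → ℝ} {K L c : ℝ}
    (hω : ContinuousOn ω (Ioc 0 ρ)) (hωpos : ∀ r ∈ Ioc 0 ρ, 0 < ω r)
    (hZ : ∀ r ∈ Ioc 0 ρ, HasDerivAt Z (Z' r) r)
    (hJ : ∀ r ∈ Ioc 0 ρ, HasDerivAt J (J' r) r)
    (hΘ : ∀ r ∈ Ioc 0 ρ, HasDerivAt Θ (θ r) r)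
    (hΘb : ∀ r ∈ Ioc 0 ρ, 0 ≤ Θ r ∧ Θ r ≤ c) (hL : 0 ≤ L)
    (he : ∀ r ∈ Ioc 0 ρ, |Z' r - J r / ω r| ≤ L * θ r)
    (hJ' : ∀ r ∈ Ioc 0 ρ, K ≤ Z r → 0 ≤ J' r)
    (hJ0 : Tendsto J (𝓝[>] 0) (𝓝 0)) :
    ∀ r ∈ Ioc 0 ρ, Z r ≤ max (Z ρ) K + 2 * (L * c) := by
  intro r1 hr1
  have hρ : 0 < ρ := hr1.1.trans_le hr1.2
  have hρm : ρ ∈ Ioc 0 ρ := ⟨hρ, le_rfl⟩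
  have hJc : ContinuousOn J (Ioc 0 ρ) := fun r hr => (hJ r hr).continuousAt.continuousWithinAt
  have hqc : ContinuousOn (fun r => J r / ω r) (Ioc 0 ρ) :=
    hJc.div hω fun r hr => (hωpos r hr).ne'
  set Y : ℝ → ℝ := fun r => Z ρ + ∫ t in ρ..r, J t / ω t with hY
  have hsub : ∀ {a b}, a ∈ Ioc 0 ρ → b ∈ Ioc 0 ρ → uIcc a b ⊆ Ioc 0 ρ := fun ha hb =>
    (convex_Ioc (𝕜 := ℝ) 0 ρ).ordConnected.uIcc_subset ha hb
  have hYd : ∀ r ∈ Ioo 0 ρ, HasDerivAt Y (J r / ω r) r := by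
    intro r hr
    have hrm : r ∈ Ioc 0 ρ := ⟨hr.1, hr.2.le⟩
    have h1 : IntervalIntegrable (fun t => J t / ω t) volume ρ r :=
      (hqc.mono (hsub hρm hrm)).intervalIntegrable
    have h2 := intervalIntegral.integral_hasDerivAt_right h1
      ((hqc.mono Ioo_subset_Ioc_self).stronglyMeasurableAtFilter isOpen_Ioo r hr)
      ((hqc.continuousAt (Ioc_mem_nhds hr.1 hr.2)))
    exact h2.const_add _
  have hYc : ContinuousOn Y (Ioc 0 ρ) := by
    intro r hr
    have h1 : IntegrableOn (fun t => J t / ω t) (uIcc (r / 2) ρ) :=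
      (hqc.mono (hsub ⟨by linarith [hr.1], by linarith [hr.1, hr.2]⟩ hρm)).integrableOn_compact
        isCompact_uIcc
    have h2 := intervalIntegral.continuousOn_primitive_interval' (a := ρ) (b₁ := r / 2) (b₂ := ρ)
      (f := fun t => J t / ω t) (h1.intervalIntegrable) right_mem_uIcc
    have hle : r / 2 ≤ ρ := by linarith [hr.1, hr.2]
    rw [uIcc_of_le hle] at h2
    have h3 := (h2.const_add (Z ρ)) r ⟨by linarith [hr.1], hr.2⟩
    refine h3.mono_of_mem_nhdsWithin ?_
    filter_upwards [self_mem_nhdsWithin, mem_nhdsWithin_of_mem_nhds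
      (Ioi_mem_nhds (show r / 2 < r by linarith [hr.1]))] with x hx hx2
    exact ⟨le_of_lt hx2, hx.2⟩
  have hYρ : Y ρ = Z ρ := by simp [hY]
  have hZc : ContinuousOn Z (Ioc 0 ρ) := fun r hr => (hZ r hr).continuousAt.continuousWithinAt
  have hΘc : ContinuousOn Θ (Ioc 0 ρ) := fun r hr => (hΘ r hr).continuousAt.continuousWithinAt
  have hcmp : ∀ r ∈ Ioc 0 ρ, |Z r - Y r| ≤ L * c := by
    intro r hr
    have hd : ∀ x ∈ Ioo 0 ρ, x ∈ Ioc 0 ρ := fun x hx => ⟨hx.1, hx.2.le⟩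
    have mono1 : MonotoneOn (fun r => Z r - Y r + L * Θ r) (Ioc 0 ρ) := by
      refine monotoneOn_of_hasDerivWithinAt_nonneg (f' := fun x => Z' x - J x / ω x + L * θ x)
        (convex_Ioc _ _) ((hZc.sub hYc).add (hΘc.const_mul _)) ?_ ?_
      · intro x hx; rw [interior_Ioc] at hx
        exact (((hZ x (hd x hx)).sub (hYd x hx)).add
          ((hΘ x (hd x hx)).const_mul L)).hasDerivWithinAt
      · intro x hx; rw [interior_Ioc] at hx
        have := abs_le.1 (he x (hd x hx)); linarith [this.1]
    have mono2 : AntitoneOn (fun r => Z r - Y r - L * Θ r) (Ioc 0 ρ) := by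
      refine antitoneOn_of_hasDerivWithinAt_nonpos (f' := fun x => Z' x - J x / ω x - L * θ x)
        (convex_Ioc _ _) ((hZc.sub hYc).sub (hΘc.const_mul _)) ?_ ?_
      · intro x hx; rw [interior_Ioc] at hx
        exact (((hZ x (hd x hx)).sub (hYd x hx)).sub
          ((hΘ x (hd x hx)).const_mul L)).hasDerivWithinAt
      · intro x hx; rw [interior_Ioc] at hx
        have := abs_le.1 (he x (hd x hx)); linarith [this.2]
    have a1 := mono1 hr hρm hr.2
    have a2 := mono2 hr hρm hr.2
    simp only [hYρ] at a1 a2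
    have b1 := hΘb r hr
    have b2 := hΘb ρ hρm
    have : L * Θ ρ ≤ L * c := by gcongr; exact b2.2
    have : 0 ≤ L * Θ r := mul_nonneg hL b1.1
    rw [abs_le]; constructor <;> linarith
  set Λ := max (Z ρ) K + L * c with hΛ
  have hLc : 0 ≤ L * c := mul_nonneg hL ((hΘb ρ hρm).1.trans (hΘb ρ hρm).2)
  suffices h : Y r1 ≤ Λ by
    have := (abs_le.1 (hcmp r1 hr1)).2
    rw [hΛ] at h; linarith
  by_contra! hcon
  have hpos : ∀ r ∈ Ioc 0 ρ, Λ < Y r → 0 ≤ J' r := by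
    intro r hr h
    apply hJ' r hr
    have := (abs_le.1 (hcmp r hr)).1
    have := le_max_right (Z ρ) K
    linarith
  have hr1ρ : r1 < ρ := by
    refine lt_of_le_of_ne hr1.2 ?_
    rintro rfl
    have := le_max_left (Z r1) K
    rw [hYρ] at hcon; linarith
  have monoJ : ∀ a b, a ∈ Ioc 0 ρ → b ∈ Ioc 0 ρ → (∀ x ∈ Ioo a b, Λ < Y x) →
      MonotoneOn J (Icc a b) := by
    intro a b ha hb hx
    have hs : Icc a b ⊆ Ioc 0 ρ := Icc_subset_uIcc.trans (hsub ha hb)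
    refine monotoneOn_of_hasDerivWithinAt_nonneg (f' := J') (convex_Icc _ _) (hJc.mono hs) ?_ ?_
    · intro x hxm; rw [interior_Icc] at hxm
      exact (hJ x (hs (Ioo_subset_Icc_self hxm))).hasDerivWithinAt
    · intro x hxm; rw [interior_Icc] at hxm
      exact hpos x (hs (Ioo_subset_Icc_self hxm)) (hx x hxm)
  rcases le_or_gt 0 (J r1) with hJ1 | hJ1
  · -- move right to the first point where `Y ≤ Λ`
    have hs : Icc r1 ρ ⊆ Ioc 0 ρ := fun x hx => ⟨hr1.1.trans_le hx.1, hx.2⟩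
    set T := Icc r1 ρ ∩ Y ⁻¹' Iic Λ with hT
    have hTc : IsCompact T :=
      isCompact_Icc.of_isClosed_subset
        ((hYc.mono hs).preimage_isClosed_of_isClosed isClosed_Icc isClosed_Iic) inter_subset_left
    have hTn : T.Nonempty := ⟨ρ, ⟨hr1.2, le_rfl⟩, by
      have := le_max_left (Z ρ) K
      simp only [mem_preimage, mem_Iic, hYρ]; linarith⟩
    obtain ⟨b, hbT, hbmin⟩ := hTc.exists_isLeast hTn
    have hb : b ∈ Ioc 0 ρ := hs hbT.1
    have hgt : ∀ x ∈ Ioo r1 b, Λ < Y x := by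
      intro x hx
      by_contra! hx2
      have : b ≤ x := hbmin ⟨⟨hx.1.le, hx.2.le.trans hb.2⟩, hx2⟩
      linarith [hx.2]
    have hm := monoJ r1 b hr1 hb hgt
    have hmY : MonotoneOn Y (Icc r1 b) := by
      have hs' : Icc r1 b ⊆ Ioc 0 ρ := Icc_subset_uIcc.trans (hsub hr1 hb)
      refine monotoneOn_of_hasDerivWithinAt_nonneg (f' := fun r => J r / ω r) (convex_Icc _ _)
        (hYc.mono hs') ?_ ?_
      · intro x hxm; rw [interior_Icc] at hxm
        exact (hYd x ⟨hr1.1.trans hxm.1, hxm.2.trans_le hb.2⟩).hasDerivWithinAt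
      · intro x hxm; rw [interior_Icc] at hxm
        have hx := Ioo_subset_Icc_self hxm
        exact div_nonneg (hJ1.trans (hm ⟨le_rfl, hbT.1.1⟩ hx hx.1)) (hωpos x (hs' hx)).le
    have := hmY ⟨le_rfl, hbT.1.1⟩ ⟨hbT.1.1, le_rfl⟩ hbT.1.1
    have h3 : Y b ≤ Λ := hbT.2
    linarith
  · -- move left to the origin
    have hall : ∀ a ∈ Ioo 0 r1, Λ < Y a := by
      intro a ha
      by_contra! haY
      have hs : Icc a r1 ⊆ Ioc 0 ρ := fun x hx => ⟨ha.1.trans_le hx.1, hx.2.trans hr1.2⟩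
      set T := Icc a r1 ∩ Y ⁻¹' Iic Λ with hT
      have hTc : IsCompact T :=
        isCompact_Icc.of_isClosed_subset
          ((hYc.mono hs).preimage_isClosed_of_isClosed isClosed_Icc isClosed_Iic) inter_subset_left
      obtain ⟨b, hbT, hbmax⟩ := hTc.exists_isGreatest ⟨a, ⟨le_rfl, ha.2.le⟩, haY⟩
      have hb : b ∈ Ioc 0 ρ := hs hbT.1
      have hgt : ∀ x ∈ Ioo b r1, Λ < Y x := by
        intro x hx
        by_contra! hx2
        have : x ≤ b := hbmax ⟨⟨hbT.1.1.trans hx.1.le, hx.2.le⟩, hx2⟩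
        linarith [hx.1]
      have hm := monoJ b r1 hb hr1 hgt
      have hmY : AntitoneOn Y (Icc b r1) := by
        have hs' : Icc b r1 ⊆ Ioc 0 ρ := Icc_subset_uIcc.trans (hsub hb hr1)
        refine antitoneOn_of_hasDerivWithinAt_nonpos (f' := fun r => J r / ω r) (convex_Icc _ _)
          (hYc.mono hs') ?_ ?_
        · intro x hxm; rw [interior_Icc] at hxm
          exact (hYd x ⟨hb.1.trans hxm.1, hxm.2.trans hr1ρ⟩).hasDerivWithinAt
        · intro x hxm; rw [interior_Icc] at hxm
          have hx := Ioo_subset_Icc_self hxm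
          exact div_nonpos_of_nonpos_of_nonneg
            ((hm hx ⟨hbT.1.2, le_rfl⟩ hx.2).trans hJ1.le) (hωpos x (hs' hx)).le
      have := hmY ⟨le_rfl, hbT.1.2⟩ ⟨hbT.1.2, le_rfl⟩ hbT.1.2
      have h3 : Y b ≤ Λ := hbT.2
      linarith
    have hJle : ∀ a ∈ Ioo 0 r1, J a ≤ J r1 := by
      intro a ha
      have := monoJ a r1 ⟨ha.1, ha.2.le.trans hr1.2⟩ hr1
        (fun x hx => hall x ⟨ha.1.trans hx.1, hx.2⟩)
      exact this ⟨le_rfl, ha.2.le⟩ ⟨ha.2.le, le_rfl⟩ ha.2.le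
    have : (0 : ℝ) ≤ J r1 := by
      refine le_of_tendsto hJ0 ?_
      filter_upwards [Ioo_mem_nhdsGT hr1.1] with a ha using hJle a ha
    linarith

theorem le_of_flux {ρ : ℝ} {Z Z' J J' ω Θ θ : ℝ → ℝ} {K N c b : ℝ}
    (hω : ContinuousOn ω (Ioc 0 ρ)) (hωpos : ∀ r ∈ Ioc 0 ρ, 0 < ω r)
    (hZ : ∀ r ∈ Ioc 0 ρ, HasDerivAt Z (Z' r) r)
    (hZ0 : ∀ r ∈ Ioc 0 ρ, 0 ≤ Z r) (hZb : ∀ r ∈ Ioc 0 ρ, Z r ≤ b)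
    (hJ : ∀ r ∈ Ioc 0 ρ, HasDerivAt J (J' r) r)
    (hΘ : ∀ r ∈ Ioc 0 ρ, HasDerivAt Θ (θ r) r)
    (hθ : ∀ r ∈ Ioc 0 ρ, 0 ≤ θ r)
    (hΘb : ∀ r ∈ Ioc 0 ρ, 0 ≤ Θ r ∧ Θ r ≤ c) (hN : 0 ≤ N) (hK : 0 ≤ K)
    (he : ∀ r ∈ Ioc 0 ρ, |Z' r - J r / ω r| ≤ 2 * N * √(Z r) * θ r)
    (hJ' : ∀ r ∈ Ioc 0 ρ, K ≤ Z r → 0 ≤ J' r)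
    (hJ0 : Tendsto J (𝓝[>] 0) (𝓝 0)) :
    ∀ r ∈ Ioc 0 ρ, Z r ≤ 2 * (Z ρ + K) + 16 * c ^ 2 * N ^ 2 := by
  intro r hr
  have hρ : 0 < ρ := hr.1.trans_le hr.2
  have hρm : ρ ∈ Ioc 0 ρ := ⟨hρ, le_rfl⟩
  have hbdd : BddAbove (Z '' Ioc 0 ρ) := ⟨b, by rintro _ ⟨x, hx, rfl⟩; exact hZb x hx⟩
  set S := sSup (Z '' Ioc 0 ρ) with hS
  have hle : ∀ x ∈ Ioc 0 ρ, Z x ≤ S := fun x hx => le_csSup hbdd ⟨x, hx, rfl⟩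
  have hS0 : 0 ≤ S := (hZ0 r hr).trans (hle r hr)
  have h1 := le_max_add_of_flux (L := 2 * N * √S) hω hωpos hZ hJ hΘ hΘb (by positivity)
    (fun x hx => (he x hx).trans (by
      have := hθ x hx
      have := Real.sqrt_le_sqrt (hle x hx)
      gcongr)) hJ' hJ0
  have h2 : S ≤ max (Z ρ) K + 2 * (2 * N * √S * c) :=
    csSup_le ⟨_, ⟨r, hr, rfl⟩⟩ (by rintro _ ⟨x, hx, rfl⟩; exact h1 x hx)
  have h3 : max (Z ρ) K ≤ Z ρ + K := max_le (by linarith) (by linarith [hZ0 ρ hρm])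
  have h4 := Real.sq_sqrt hS0
  refine (hle r hr).trans ?_
  nlinarith [sq_nonneg (√S - 4 * N * c)]

/-- A radial comparison function `φ` for the reduced operator, uniformly in the coefficient
`p = r² / (ε + r²) ∈ [0, 1]`. -/
structure IsBarrier (m γ κ R₀ c Cφ Cκ CΘ : ℝ) (φ φ' φ'' Θ θ : ℝ → ℝ) : Prop where
  pos : ∀ r ∈ Ioc 0 R₀, 0 < φ r
  hasDerivAt : ∀ r ∈ Ioc 0 R₀, HasDerivAt φ (φ' r) r
  hasDerivAt' : ∀ r ∈ Ioc 0 R₀, HasDerivAt φ' (φ'' r) r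
  super : ∀ r ∈ Ioc 0 R₀, ∀ p ∈ Icc (0 : ℝ) 1,
    r ^ 2 * φ'' r + (m - 1) * (r * φ' r) + 2 * p * (r * φ' r) - (m - 1) * φ r - 2 / γ * p * φ r
      ≤ -(c * r ^ κ)
  deriv_le : ∀ r ∈ Ioc 0 R₀, |r * φ' r| ≤ Cφ * φ r
  rpow_le : ∀ r ∈ Ioc 0 R₀, r ^ κ ≤ Cκ * φ r
  hasDerivAt_weight : ∀ r ∈ Ioc 0 R₀, HasDerivAt Θ (θ r) r
  le_weight : ∀ r ∈ Ioc 0 R₀, r ^ κ / (r * φ r) ≤ θ r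
  weight_mem : ∀ r ∈ Ioc 0 R₀, 0 ≤ Θ r ∧ Θ r ≤ CΘ
  linear_le : ∃ C, ∀ r ∈ Ioc 0 R₀, r ≤ C * φ r

/-- The indicial polynomial of the reduced operator on first spherical harmonics. -/
noncomputable def indicial (m γ p x : ℝ) : ℝ := x ^ 2 + (m - 2 + 2 * p) * x - (m - 1) - 2 / γ * p

theorem hasDerivAt_two_rpow (c₁ c₂ a b : ℝ) {r : ℝ} (hr : 0 < r) :
    HasDerivAt (fun r : ℝ => c₁ * r ^ a + c₂ * r ^ b)
      (c₁ * (a * r ^ (a - 1)) + c₂ * (b * r ^ (b - 1))) r :=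
  ((Real.hasDerivAt_rpow_const (Or.inl hr.ne')).const_mul c₁).add
    ((Real.hasDerivAt_rpow_const (Or.inl hr.ne')).const_mul c₂)

theorem hasDerivAt_two_rpow' (c₁ c₂ a b : ℝ) {r : ℝ} (hr : 0 < r) :
    HasDerivAt (fun r : ℝ => c₁ * (a * r ^ (a - 1)) + c₂ * (b * r ^ (b - 1)))
      (c₁ * (a * ((a - 1) * r ^ (a - 2))) + c₂ * (b * ((b - 1) * r ^ (b - 2)))) r := by
  have h : ∀ a : ℝ, HasDerivAt (fun r : ℝ => r ^ (a - 1)) ((a - 1) * r ^ (a - 2)) r := fun a => by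
    have := Real.hasDerivAt_rpow_const (x := r) (p := a - 1) (Or.inl hr.ne')
    rwa [show a - 1 - 1 = a - 2 by ring] at this
  exact (((h a).const_mul a).const_mul c₁).add (((h b).const_mul b).const_mul c₂)

theorem mul_rpow_sub_one {r : ℝ} (hr : 0 < r) (a : ℝ) : r * r ^ (a - 1) = r ^ a := by
  rw [Real.rpow_sub_one hr.ne']; field_simp

theorem sq_mul_rpow_sub_two {r : ℝ} (hr : 0 < r) (a : ℝ) : r ^ 2 * r ^ (a - 2) = r ^ a := by
  rw [Real.rpow_sub hr, Real.rpow_two]; field_simp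

theorem reduced_two_rpow (m γ p c₁ c₂ a b : ℝ) {r : ℝ} (hr : 0 < r) :
    r ^ 2 * (c₁ * (a * ((a - 1) * r ^ (a - 2))) + c₂ * (b * ((b - 1) * r ^ (b - 2))))
      + (m - 1) * (r * (c₁ * (a * r ^ (a - 1)) + c₂ * (b * r ^ (b - 1))))
      + 2 * p * (r * (c₁ * (a * r ^ (a - 1)) + c₂ * (b * r ^ (b - 1))))
      - (m - 1) * (c₁ * r ^ a + c₂ * r ^ b) - 2 / γ * p * (c₁ * r ^ a + c₂ * r ^ b)
      = c₁ * r ^ a * indicial m γ p a + c₂ * r ^ b * indicial m γ p b := by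
  rw [← sq_mul_rpow_sub_two hr a, ← sq_mul_rpow_sub_two hr b, ← mul_rpow_sub_one hr (a - 1),
    ← mul_rpow_sub_one hr (b - 1), show a - 1 - 1 = a - 2 by ring, show b - 1 - 1 = b - 2 by ring]
  unfold indicial
  ring

theorem indicial_convex (m γ p x : ℝ) :
    indicial m γ p x = (1 - p) * indicial m γ 0 x + p * indicial m γ 1 x := by
  unfold indicial; ring

theorem indicial_zero (m γ x : ℝ) : indicial m γ 0 x = (x - 1) * (x + m - 1) := by
  unfold indicial; ring

theorem indicial_one {m γ α : ℝ} (hα : α ^ 2 + m * α = m - 1 + 2 / γ) (x : ℝ) :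
    indicial m γ 1 x = (x - α) * (x + m + α) := by
  unfold indicial; linear_combination hα

theorem exists_indicial_le {m γ α : ℝ} (hm : 1 ≤ m) (hα0 : 0 < α)
    (hα : α ^ 2 + m * α = m - 1 + 2 / γ) {x : ℝ} (hx0 : 0 < x) (hx : x < min α 1) :
    ∃ c > 0, ∀ p ∈ Icc (0 : ℝ) 1, indicial m γ p x ≤ -c := by
  have h1 : 0 < (1 - x) * (x + m - 1) :=
    mul_pos (by linarith [hx.trans_le (min_le_right _ _)]) (by linarith)
  have h2 : 0 < (α - x) * (x + m + α) :=
    mul_pos (by linarith [hx.trans_le (min_le_left _ _)]) (by linarith)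
  refine ⟨min ((1 - x) * (x + m - 1)) ((α - x) * (x + m + α)), lt_min h1 h2, fun p hp => ?_⟩
  rw [indicial_convex, indicial_zero, indicial_one hα]
  have h3 := min_le_left ((1 - x) * (x + m - 1)) ((α - x) * (x + m + α))
  have h4 := min_le_right ((1 - x) * (x + m - 1)) ((α - x) * (x + m + α))
  nlinarith [hp.1, hp.2, mul_le_mul_of_nonneg_left h3 (by linarith [hp.2] : 0 ≤ 1 - p),
    mul_le_mul_of_nonneg_left h4 hp.1]

theorem isBarrier_of_lt {m γ α κ R₀ : ℝ} (hm : 1 ≤ m) (hα0 : 0 < α)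
    (hα : α ^ 2 + m * α = m - 1 + 2 / γ) (hκ0 : 0 < κ) (hR₀ : 0 < R₀) (hκ : κ < min α 1) :
    ∃ c Cφ Cκ CΘ C₁ c₂ : ℝ, 0 < c ∧ 0 < Cφ ∧ 0 < Cκ ∧ 0 < CΘ ∧ 0 < C₁ ∧ 0 < c₂ ∧
      ∀ R : ℝ, 0 < R → ∃ φ φ' φ'' Θ θ : ℝ → ℝ,
        IsBarrier m γ κ R₀ c Cφ Cκ CΘ φ φ' φ'' Θ θ ∧ φ R ≤ C₁ * R ^ κ ∧
          ∀ r ∈ Icc (R₀ / 2) R₀, c₂ ≤ φ r := by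
  set τ := min κ (min α 1 - κ) / 2 with hτ
  have hτ0 : 0 < τ := half_pos (lt_min hκ0 (by linarith))
  have ha0 : 0 < κ - τ := by have := min_le_left κ (min α 1 - κ); linarith
  have hb1 : κ + τ < min α 1 := by have := min_le_right κ (min α 1 - κ); linarith
  obtain ⟨ca, hca, hqa⟩ := exists_indicial_le (γ := γ) hm hα0 hα ha0 (by linarith)
  obtain ⟨cb, hcb, hqb⟩ := exists_indicial_le (γ := γ) hm hα0 hα (by linarith : 0 < κ + τ) hb1
  refine ⟨2 * min ca cb, κ + τ, 1, Real.pi / τ, 2, 2 * (R₀ / 2) ^ κ, by positivity, by positivity,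
    one_pos, by positivity, two_pos, by positivity, fun R hR => ?_⟩
  have hRτ : 0 < R ^ τ := Real.rpow_pos_of_pos hR τ
  have key : ∀ r : ℝ, 0 < r → R ^ τ * r ^ (κ - τ) + (R ^ τ)⁻¹ * r ^ (κ + τ)
      = r ^ κ * ((r / R) ^ τ + ((r / R) ^ τ)⁻¹) := by
    intro r hr
    have hrτ : 0 < r ^ τ := Real.rpow_pos_of_pos hr τ
    rw [Real.rpow_sub hr, Real.rpow_add hr, Real.div_rpow hr.le hR.le]
    field_simp
    ring
  have hx : ∀ r : ℝ, 0 < r → 2 ≤ (r / R) ^ τ + ((r / R) ^ τ)⁻¹ := by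
    intro r hr
    have h : 0 < (r / R) ^ τ := Real.rpow_pos_of_pos (div_pos hr hR) τ
    have : (r / R) ^ τ + ((r / R) ^ τ)⁻¹ - 2 = ((r / R) ^ τ - 1) ^ 2 / (r / R) ^ τ := by
      field_simp; ring
    have : 0 ≤ ((r / R) ^ τ - 1) ^ 2 / (r / R) ^ τ := by positivity
    linarith
  have hge : ∀ r : ℝ, 0 < r → 2 * r ^ κ ≤ R ^ τ * r ^ (κ - τ) + (R ^ τ)⁻¹ * r ^ (κ + τ) := by
    intro r hr
    rw [key r hr]
    have := Real.rpow_pos_of_pos hr κ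
    nlinarith [hx r hr]
  refine ⟨fun r => R ^ τ * r ^ (κ - τ) + (R ^ τ)⁻¹ * r ^ (κ + τ),
    fun r => R ^ τ * ((κ - τ) * r ^ (κ - τ - 1)) + (R ^ τ)⁻¹ * ((κ + τ) * r ^ (κ + τ - 1)),
    fun r => R ^ τ * ((κ - τ) * ((κ - τ - 1) * r ^ (κ - τ - 2)))
      + (R ^ τ)⁻¹ * ((κ + τ) * ((κ + τ - 1) * r ^ (κ + τ - 2))),
    fun r => Real.arctan ((r / R) ^ τ) / τ,
    fun r => r ^ κ / (r * (R ^ τ * r ^ (κ - τ) + (R ^ τ)⁻¹ * r ^ (κ + τ))),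
    ⟨?_, ?_, ?_, ?_, ?_, ?_, ?_, ?_, ?_, ?_⟩, ?_, ?_⟩
  · intro r hr
    have := Real.rpow_pos_of_pos hr.1 κ
    linarith [hge r hr.1]
  · exact fun r hr => hasDerivAt_two_rpow _ _ _ _ hr.1
  · exact fun r hr => hasDerivAt_two_rpow' _ _ _ _ hr.1
  · intro r hr p hp
    rw [reduced_two_rpow _ _ _ _ _ _ _ hr.1]
    have h1 : 0 ≤ R ^ τ * r ^ (κ - τ) := mul_nonneg hRτ.le (Real.rpow_nonneg hr.1.le _)
    have h2 : 0 ≤ (R ^ τ)⁻¹ * r ^ (κ + τ) :=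
      mul_nonneg (inv_nonneg.2 hRτ.le) (Real.rpow_nonneg hr.1.le _)
    have h3 : indicial m γ p (κ - τ) ≤ -min ca cb :=
      (hqa p hp).trans (neg_le_neg (min_le_left _ _))
    have h4 : indicial m γ p (κ + τ) ≤ -min ca cb :=
      (hqb p hp).trans (neg_le_neg (min_le_right _ _))
    have h5 := mul_le_mul_of_nonneg_left h3 h1
    have h6 := mul_le_mul_of_nonneg_left h4 h2
    have h7 := mul_le_mul_of_nonneg_left (hge r hr.1) (lt_min hca hcb).le
    linarith
  · intro r hr
    have h1 : 0 ≤ R ^ τ * r ^ (κ - τ) := mul_nonneg hRτ.le (Real.rpow_nonneg hr.1.le _)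
    have h2 : 0 ≤ (R ^ τ)⁻¹ * r ^ (κ + τ) :=
      mul_nonneg (inv_nonneg.2 hRτ.le) (Real.rpow_nonneg hr.1.le _)
    have : r * (R ^ τ * ((κ - τ) * r ^ (κ - τ - 1)) + (R ^ τ)⁻¹ * ((κ + τ) * r ^ (κ + τ - 1)))
        = (κ - τ) * (R ^ τ * r ^ (κ - τ)) + (κ + τ) * ((R ^ τ)⁻¹ * r ^ (κ + τ)) := by
      rw [← mul_rpow_sub_one hr.1 (κ - τ), ← mul_rpow_sub_one hr.1 (κ + τ)]; ring
    rw [this, abs_of_nonneg (by positivity)]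
    nlinarith
  · intro r hr
    have := Real.rpow_pos_of_pos hr.1 κ
    linarith [hge r hr.1]
  · intro r hr
    have hr0 := hr.1
    have h : 0 < (r / R) ^ τ := Real.rpow_pos_of_pos (div_pos hr.1 hR) τ
    have h1 : HasDerivAt (fun r : ℝ => (r / R) ^ τ) (1 / R * τ * (r / R) ^ (τ - 1)) r :=
      ((hasDerivAt_id r).div_const R).rpow_const (Or.inl (div_pos hr.1 hR).ne')
    have h2 := (h1.arctan).div_const τ
    refine h2.congr_deriv ?_
    rw [key r hr.1, Real.rpow_sub_one (div_pos hr.1 hR).ne']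
    have := Real.rpow_pos_of_pos hr.1 κ
    field_simp
    ring
  · exact fun r _ => le_rfl
  · intro r hr
    have h : 0 ≤ (r / R) ^ τ := (Real.rpow_pos_of_pos (div_pos hr.1 hR) τ).le
    refine ⟨div_nonneg (Real.arctan_nonneg.2 h) hτ0.le, ?_⟩
    have := Real.arctan_lt_pi_div_two ((r / R) ^ τ)
    have := Real.pi_pos
    gcongr; linarith
  · refine ⟨(R ^ τ)⁻¹ * R₀ ^ (1 - (κ - τ)), fun r hr => ?_⟩
    have h2 : 0 ≤ (R ^ τ)⁻¹ * r ^ (κ + τ) :=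
      mul_nonneg (inv_nonneg.2 hRτ.le) (Real.rpow_nonneg hr.1.le _)
    have h3 : r = r ^ (1 - (κ - τ)) * r ^ (κ - τ) := by
      rw [← Real.rpow_add hr.1]; simp
    have h4 : r ^ (1 - (κ - τ)) ≤ R₀ ^ (1 - (κ - τ)) :=
      Real.rpow_le_rpow hr.1.le hr.2 (by linarith [min_le_right α 1])
    have h5 := Real.rpow_pos_of_pos hr.1 (κ - τ)
    have h6 : 0 ≤ (R ^ τ)⁻¹ * R₀ ^ (1 - (κ - τ)) * ((R ^ τ)⁻¹ * r ^ (κ + τ)) := by positivity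
    have h7 : (R ^ τ)⁻¹ * R₀ ^ (1 - (κ - τ)) * (R ^ τ * r ^ (κ - τ))
      = R₀ ^ (1 - (κ - τ)) * r ^ (κ - τ) := by field_simp
    rw [mul_add, h7]
    calc r = r ^ (1 - (κ - τ)) * r ^ (κ - τ) := h3
      _ ≤ R₀ ^ (1 - (κ - τ)) * r ^ (κ - τ) := by gcongr
      _ ≤ _ := le_add_of_nonneg_right h6
  · show R ^ τ * R ^ (κ - τ) + (R ^ τ)⁻¹ * R ^ (κ + τ) ≤ 2 * R ^ κ
    rw [key R hR, div_self hR.ne']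
    simp; linarith
  · intro r hr
    have hr0 : 0 < r := by linarith [hr.1]
    refine le_trans ?_ (hge r hr0)
    have := hr.1
    gcongr

theorem isBarrier_of_gt {m γ α κ R₀ : ℝ} (hm : 1 ≤ m) (hα0 : 0 < α)
    (hα : α ^ 2 + m * α = m - 1 + 2 / γ) (hR₀ : 0 < R₀) (hκ : min α 1 < κ) :
    ∃ c Cφ Cκ CΘ C₁ c₂ : ℝ, 0 < c ∧ 0 < Cφ ∧ 0 < Cκ ∧ 0 < CΘ ∧ 0 < C₁ ∧ 0 < c₂ ∧
      ∃ φ φ' φ'' Θ θ : ℝ → ℝ,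
        IsBarrier m γ κ R₀ c Cφ Cκ CΘ φ φ' φ'' Θ θ ∧
          (∀ R, 0 < R → φ R ≤ C₁ * R ^ min α 1) ∧
          ∀ r ∈ Icc (R₀ / 2) R₀, c₂ ≤ φ r := by
  set β := min α 1 with hβ
  have hβ0 : 0 < β := lt_min hα0 one_pos
  have hβ1 : β ≤ 1 := min_le_right _ _
  have hβα : β ≤ α := min_le_left _ _
  set τ := κ - β with hτ
  have hτ0 : 0 < τ := by linarith
  have hκβ : κ = β + τ := by linarith
  have hκ0 : 0 < κ := by linarith
  -- the indicial polynomial at `β` dominates once multiplied by a large constant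
  obtain ⟨K, c, hK, hc, hKc⟩ : ∃ K c : ℝ, 2 ≤ K ∧ 0 < c ∧ ∀ p ∈ Icc (0 : ℝ) 1,
      K * indicial m γ p β - indicial m γ p κ ≤ -c := by
    have h1 : ∀ K : ℝ, 2 ≤ K →
        K * indicial m γ 1 β - indicial m γ 1 κ ≤ -(τ * (2 * β + τ + m)) := by
      intro K hK
      have e : K * indicial m γ 1 β - indicial m γ 1 κ
        = (K - 1) * indicial m γ 1 β - τ * (2 * β + τ + m) := by
        rw [hκβ]; unfold indicial; ring
      rw [e, indicial_one hα]
      have : 0 ≤ (K - 1) * ((α - β) * (β + m + α)) :=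
        mul_nonneg (by linarith) (mul_nonneg (by linarith) (by linarith))
      nlinarith
    have h0 : ∃ K c : ℝ, 2 ≤ K ∧ 0 < c ∧ K * indicial m γ 0 β - indicial m γ 0 κ ≤ -c := by
      have e : ∀ K : ℝ, K * indicial m γ 0 β - indicial m γ 0 κ
        = -((K - 1) * ((1 - β) * (β + m - 1))) - τ * (2 * β + τ + m - 2) := by
        intro K; rw [hκβ]; unfold indicial; ring
      rcases hβ1.eq_or_lt with h | h
      · refine ⟨2, τ * (τ + m), le_rfl, by positivity, ?_⟩
        rw [e, h]; linarith
      · have hd : 0 < (1 - β) * (β + m - 1) := mul_pos (by linarith) (by linarith)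
        refine ⟨2 + (τ + 1) / ((1 - β) * (β + m - 1)), 1, by
          have : 0 ≤ (τ + 1) / ((1 - β) * (β + m - 1)) := by positivity
          linarith, one_pos, ?_⟩
        rw [e]
        have : (2 + (τ + 1) / ((1 - β) * (β + m - 1)) - 1) * ((1 - β) * (β + m - 1))
          = (1 - β) * (β + m - 1) + (τ + 1) := by
          rw [show 2 + (τ + 1) / ((1 - β) * (β + m - 1)) - 1
            = 1 + (τ + 1) / ((1 - β) * (β + m - 1)) by ring, add_mul, one_mul,
            div_mul_cancel₀ _ hd.ne']
        rw [this]
        nlinarith [mul_pos hτ0 hβ0, mul_pos hτ0 hτ0]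
    obtain ⟨K, c, hK, hc, h0⟩ := h0
    have h2 : 0 < τ * (2 * β + τ + m) := by positivity
    refine ⟨K, min c (τ * (2 * β + τ + m)), hK, lt_min hc h2, fun p hp => ?_⟩
    rw [indicial_convex m γ p β, indicial_convex m γ p κ]
    have h3 := min_le_left c (τ * (2 * β + τ + m))
    have h4 := min_le_right c (τ * (2 * β + τ + m))
    have h5 := mul_le_mul_of_nonneg_left (h0.trans (neg_le_neg h3)) (by linarith [hp.2] : 0 ≤ 1 - p)
    have h6 := mul_le_mul_of_nonneg_left ((h1 K hK).trans (neg_le_neg h4)) hp.1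
    linarith
  have hRτ : 0 < R₀ ^ τ := Real.rpow_pos_of_pos hR₀ τ
  have key : ∀ r ∈ Ioc 0 R₀, ∃ x : ℝ, 0 < x ∧ x ≤ 1 ∧ (R₀ ^ τ)⁻¹ * r ^ κ = x * r ^ β := by
    intro r hr
    refine ⟨(R₀ ^ τ)⁻¹ * r ^ τ, by have := Real.rpow_pos_of_pos hr.1 τ; positivity, ?_, ?_⟩
    · rw [inv_mul_le_iff₀ hRτ, mul_one]
      exact Real.rpow_le_rpow hr.1.le hr.2 hτ0.le
    · rw [hκβ, Real.rpow_add hr.1]; ring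
  have hge : ∀ r ∈ Ioc 0 R₀, r ^ β ≤ K * r ^ β + (-(R₀ ^ τ)⁻¹) * r ^ κ := by
    intro r hr
    obtain ⟨x, hx0, hx1, hx⟩ := key r hr
    rw [neg_mul, hx]
    have := Real.rpow_pos_of_pos hr.1 β
    nlinarith
  have hβq : ∀ p ∈ Icc (0 : ℝ) 1, indicial m γ p β ≤ 0 := by
    intro p hp
    rw [indicial_convex, indicial_zero, indicial_one hα]
    have h1 : 0 ≤ (1 - p) * ((1 - β) * (β + m - 1)) :=
      mul_nonneg (by linarith [hp.2]) (mul_nonneg (by linarith) (by linarith))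
    have h2 : 0 ≤ p * ((α - β) * (β + m + α)) :=
      mul_nonneg hp.1 (mul_nonneg (by linarith) (by linarith))
    nlinarith
  refine ⟨c * (R₀ ^ τ)⁻¹, K * β + κ, R₀ ^ τ, R₀ ^ τ / τ, K, (R₀ / 2) ^ β, by positivity,
    by positivity, hRτ, by positivity, by linarith, by positivity,
    fun r => K * r ^ β + (-(R₀ ^ τ)⁻¹) * r ^ κ,
    fun r => K * (β * r ^ (β - 1)) + (-(R₀ ^ τ)⁻¹) * (κ * r ^ (κ - 1)),
    fun r => K * (β * ((β - 1) * r ^ (β - 2))) + (-(R₀ ^ τ)⁻¹) * (κ * ((κ - 1) * r ^ (κ - 2))),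
    fun r => r ^ τ / τ, fun r => r ^ (τ - 1),
    ⟨?_, ?_, ?_, ?_, ?_, ?_, ?_, ?_, ?_, ?_⟩, ?_, ?_⟩
  · intro r hr
    exact (Real.rpow_pos_of_pos hr.1 β).trans_le (hge r hr)
  · exact fun r hr => hasDerivAt_two_rpow _ _ _ _ hr.1
  · exact fun r hr => hasDerivAt_two_rpow' _ _ _ _ hr.1
  · intro r hr p hp
    rw [reduced_two_rpow _ _ _ _ _ _ _ hr.1]
    obtain ⟨x, hx0, hx1, hx⟩ := key r hr
    rw [mul_assoc c, neg_mul, hx]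
    have h1 := Real.rpow_pos_of_pos hr.1 β
    have h2 := hKc p hp
    have h3 := hβq p hp
    have h4 : K * indicial m γ p β ≤ x * (K * indicial m γ p β) := by
      have : K * indicial m γ p β ≤ 0 := mul_nonpos_of_nonneg_of_nonpos (by linarith) h3
      nlinarith
    have h5 : K * indicial m γ p β - x * indicial m γ p κ ≤ -(c * x) := by nlinarith
    have h6 := mul_le_mul_of_nonneg_left h5 h1.le
    linarith
  · intro r hr
    obtain ⟨x, hx0, hx1, hx⟩ := key r hr
    have e : r * (K * (β * r ^ (β - 1)) + (-(R₀ ^ τ)⁻¹) * (κ * r ^ (κ - 1)))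
        = K * β * r ^ β - κ * ((R₀ ^ τ)⁻¹ * r ^ κ) := by
      rw [← mul_rpow_sub_one hr.1 β, ← mul_rpow_sub_one hr.1 κ]; ring
    have h1 := Real.rpow_pos_of_pos hr.1 β
    rw [e, hx]
    refine le_trans ?_ (mul_le_mul_of_nonneg_left (hge r hr) (by positivity))
    have h2 : κ * (x * r ^ β) ≤ κ * r ^ β := by
      have : x * r ^ β ≤ r ^ β := by nlinarith
      gcongr
    have h3 : 0 ≤ κ * (x * r ^ β) := by positivity
    have h4 : 0 ≤ K * β * r ^ β := by positivity
    rw [abs_le]; constructor <;> nlinarith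
  · intro r hr
    obtain ⟨x, hx0, hx1, hx⟩ := key r hr
    refine le_trans ?_ (mul_le_mul_of_nonneg_left (hge r hr) hRτ.le)
    have h1 := Real.rpow_pos_of_pos hr.1 β
    rw [inv_mul_eq_iff_eq_mul₀ hRτ.ne'] at hx
    rw [hx]
    have : x * r ^ β ≤ r ^ β := by nlinarith
    gcongr
  · intro r hr
    have := (Real.hasDerivAt_rpow_const (x := r) (p := τ) (Or.inl hr.1.ne')).div_const τ
    refine this.congr_deriv ?_
    field_simp
  · intro r hr
    have h1 := Real.rpow_pos_of_pos hr.1 β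
    have h2 := Real.rpow_pos_of_pos hr.1 τ
    have hr0 := hr.1
    have h3 := h1.trans_le (hge r hr)
    rw [div_le_iff₀ (by positivity)]
    have e : r ^ (τ - 1) * (r * (K * r ^ β + (-(R₀ ^ τ)⁻¹) * r ^ κ))
      = r ^ τ * (K * r ^ β + (-(R₀ ^ τ)⁻¹) * r ^ κ) := by
      rw [← mul_rpow_sub_one hr.1 τ]; ring
    rw [e]
    calc r ^ κ = r ^ τ * r ^ β := by rw [← Real.rpow_add hr.1, hκβ, add_comm]
      _ ≤ _ := mul_le_mul_of_nonneg_left (hge r hr) h2.le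
  · intro r hr
    have h2 := Real.rpow_pos_of_pos hr.1 τ
    refine ⟨by positivity, ?_⟩
    have := Real.rpow_le_rpow hr.1.le hr.2 hτ0.le
    gcongr
  · refine ⟨R₀ ^ (1 - β), fun r hr => ?_⟩
    have h3 : r = r ^ (1 - β) * r ^ β := by rw [← Real.rpow_add hr.1]; simp
    have h4 : r ^ (1 - β) ≤ R₀ ^ (1 - β) := Real.rpow_le_rpow hr.1.le hr.2 (by linarith)
    have h5 := Real.rpow_pos_of_pos hr.1 β
    calc r = r ^ (1 - β) * r ^ β := h3
      _ ≤ R₀ ^ (1 - β) * r ^ β := by gcongr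
      _ ≤ _ := mul_le_mul_of_nonneg_left (hge r hr) (by positivity)
  · intro R hR
    have := Real.rpow_pos_of_pos hR κ
    have : 0 ≤ (R₀ ^ τ)⁻¹ * R ^ κ := by positivity
    show K * R ^ β + (-(R₀ ^ τ)⁻¹) * R ^ κ ≤ K * R ^ β
    linarith
  · intro r hr
    refine le_trans ?_ (hge r ⟨by linarith [hr.1], hr.2⟩)
    have := hr.1
    gcongr

theorem exists_isBarrier {m γ α κ R₀ : ℝ} (hm : 1 ≤ m) (hα0 : 0 < α)
    (hα : α ^ 2 + m * α = m - 1 + 2 / γ) (hκ0 : 0 < κ) (hR₀ : 0 < R₀) (hκ : κ ≠ min α 1) :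
    ∃ c Cφ Cκ CΘ C₁ c₂ : ℝ, 0 < c ∧ 0 < Cφ ∧ 0 < Cκ ∧ 0 < CΘ ∧ 0 < C₁ ∧ 0 < c₂ ∧
      ∀ R : ℝ, 0 < R → ∃ φ φ' φ'' Θ θ : ℝ → ℝ,
        IsBarrier m γ κ R₀ c Cφ Cκ CΘ φ φ' φ'' Θ θ ∧ φ R ≤ C₁ * R ^ min (min α 1) κ ∧
          ∀ r ∈ Icc (R₀ / 2) R₀, c₂ ≤ φ r := by
  rcases hκ.lt_or_gt with h | h
  · rw [min_eq_right h.le]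
    exact isBarrier_of_lt hm hα0 hα hκ0 hR₀ h
  · obtain ⟨c, Cφ, Cκ, CΘ, C₁, c₂, h1, h2, h3, h4, h5, h6, φ, φ', φ'', Θ, θ, hB, hR, hr⟩ :=
      isBarrier_of_gt hm hα0 hα hR₀ h
    rw [min_eq_left h.le]
    exact ⟨c, Cφ, Cκ, CΘ, C₁, c₂, h1, h2, h3, h4, h5, h6,
      fun R hR0 => ⟨φ, φ', φ'', Θ, θ, hB, hR R hR0, hr⟩⟩

/-- The flux of the weighted energy is nondecreasing wherever the weighted energy is large. -/
theorem flux_deriv_nonneg {m γ κ c Cφ Cκ d N ε r p p' p'' H H' S : ℝ} (hc : 0 < c)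
    (hd : 0 < d) (hdκ : d * Cκ ≤ 1) (hdm : (m - 1) * d ≤ c / 4) (hε : 0 < ε) (hr0 : 0 < r)
    (hp : 0 < p) (hH0 : 0 ≤ H)
    (hsup : r ^ 2 * p'' + (m - 1) * (r * p') + 2 * (r ^ 2 / (ε + r ^ 2)) * (r * p')
      - (m - 1) * p - 2 / γ * (r ^ 2 / (ε + r ^ 2)) * p ≤ -(c * r ^ κ))
    (hκ : r ^ κ ≤ Cκ * p) (hψr : |p' / p| ≤ Cφ / r)
    (hS : ∀ ψ δ μ : ℝ, 0 < δ → δ ≤ 1 → 0 < μ →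
      (ε + r ^ 2) * (ψ * H' - ψ ^ 2 * H + (1 - δ) * ((m - 1) / r ^ 2 * H) - μ * H
        - (N * r ^ (κ - 1)) ^ 2 * (1 / 4 + 1 / (4 * δ) + ψ ^ 2 / (2 * μ) + 1 / (2 * μ * r ^ 2)))
        ≤ S)
    (hK : 2 * (Cκ / 4 + 1 / (4 * d) + 2 * (Cφ ^ 2 + 1) / c) / c * N ^ 2 ≤ H / p ^ 2) :
    0 ≤ S + 2 / γ * H - (m - 1) / r * ((ε + r ^ 2) * (p' / p) * H)
        - (2 * r * (p' / p) * H + (ε + r ^ 2) * (p'' / p - (p' / p) ^ 2) * H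
          + (ε + r ^ 2) * (p' / p) * H') := by
  have hA' : 0 < ε + r ^ 2 := by positivity
  have hrκ := Real.rpow_pos_of_pos hr0 κ
  have h1 := hS (p' / p) (d * r ^ κ / p) (c / 4 * r ^ κ / (r ^ 2 * p))
    (by positivity) (by
      rw [div_le_one hp]
      calc d * r ^ κ ≤ d * (Cκ * p) := by gcongr
        _ = d * Cκ * p := by ring
        _ ≤ p := by nlinarith) (by positivity)
  set ψ := p' / p with hψdef
  have hp' : p' = ψ * p := by rw [hψdef]; field_simp
  set C₁ := Cκ / 4 + 1 / (4 * d) + 2 * (Cφ ^ 2 + 1) / c with hC₁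
  -- the error terms
  have hE : (N * r ^ (κ - 1)) ^ 2 * (1 / 4 + 1 / (4 * (d * r ^ κ / p))
      + ψ ^ 2 / (2 * (c / 4 * r ^ κ / (r ^ 2 * p)))
      + 1 / (2 * (c / 4 * r ^ κ / (r ^ 2 * p)) * r ^ 2))
      ≤ C₁ * N ^ 2 * (r ^ κ * p / r ^ 2) := by
    have e1 : (N * r ^ (κ - 1)) ^ 2 = N ^ 2 * (r ^ κ / r ^ 2) * r ^ κ := by
      rw [Real.rpow_sub_one hr0.ne']; field_simp
    have e2 : ψ ^ 2 ≤ Cφ ^ 2 / r ^ 2 := by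
      rw [← sq_abs, ← div_pow]; exact pow_le_pow_left₀ (abs_nonneg _) hψr 2
    have e3 : r ^ κ * (1 / 4 + 1 / (4 * (d * r ^ κ / p))
      + ψ ^ 2 / (2 * (c / 4 * r ^ κ / (r ^ 2 * p)))
      + 1 / (2 * (c / 4 * r ^ κ / (r ^ 2 * p)) * r ^ 2))
      = r ^ κ / 4 + 1 / (4 * d) * p + 2 / c * (ψ ^ 2 * r ^ 2 + 1) * p := by
      field_simp
      ring
    have e4 : ψ ^ 2 * r ^ 2 ≤ Cφ ^ 2 := by rwa [le_div_iff₀ (by positivity)] at e2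
    rw [e1, mul_assoc, e3]
    have e5 : r ^ κ / 4 + 1 / (4 * d) * p + 2 / c * (ψ ^ 2 * r ^ 2 + 1) * p
        ≤ C₁ * p := by
      have a1 := hκ
      have a2 : 2 / c * (ψ ^ 2 * r ^ 2 + 1) * p ≤ 2 / c * (Cφ ^ 2 + 1) * p := by gcongr
      have a3 : 2 * (Cφ ^ 2 + 1) / c = 2 / c * (Cφ ^ 2 + 1) := by ring
      rw [hC₁, a3, add_mul, add_mul]
      linarith
    calc _ ≤ N ^ 2 * (r ^ κ / r ^ 2) * (C₁ * p) := by gcongr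
      _ = _ := by ring
  -- the zeroth order terms
  have hz : c * r ^ κ / (r ^ 2 * p) ≤ (m - 1) / r ^ 2 + 2 / γ / (ε + r ^ 2)
      - 2 * r * ψ / (ε + r ^ 2) - p'' / p - (m - 1) * ψ / r := by
    have e : (m - 1) / r ^ 2 + 2 / γ / (ε + r ^ 2)
        - 2 * r * ψ / (ε + r ^ 2) - p'' / p - (m - 1) * ψ / r
        = -(r ^ 2 * p'' + (m - 1) * (r * p') + 2 * (r ^ 2 / (ε + r ^ 2)) * (r * p')
          - (m - 1) * p - 2 / γ * (r ^ 2 / (ε + r ^ 2)) * p) / (r ^ 2 * p) := by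
      rw [hp', ← mul_one_div (2 : ℝ) γ]
      generalize 1 / γ = g
      field_simp
      ring
    rw [e]
    gcongr
    linarith
  have hδ : d * r ^ κ / p * ((m - 1) / r ^ 2) + c / 4 * r ^ κ / (r ^ 2 * p)
      ≤ c / 2 * r ^ κ / (r ^ 2 * p) := by
    have e : d * r ^ κ / p * ((m - 1) / r ^ 2) = (m - 1) * d * (r ^ κ / (r ^ 2 * p)) := by
      field_simp
    have e1 : (m - 1) * d * (r ^ κ / (r ^ 2 * p)) ≤ c / 4 * (r ^ κ / (r ^ 2 * p)) := by gcongr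
    rw [e, mul_div_assoc, mul_div_assoc]
    linarith
  have hK' : C₁ * N ^ 2 * (r ^ κ * p / r ^ 2) ≤ c / 2 * r ^ κ / (r ^ 2 * p) * H := by
    have e : c / 2 * r ^ κ / (r ^ 2 * p) * H
      = c / 2 * (H / p ^ 2) * (r ^ κ * p / r ^ 2) := by field_simp
    rw [e]
    refine mul_le_mul_of_nonneg_right ?_ (by positivity)
    calc C₁ * N ^ 2 = c / 2 * (2 * C₁ / c * N ^ 2) := by field_simp
      _ ≤ _ := by gcongr
  have hz' := mul_le_mul_of_nonneg_right hz hH0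
  have hδ' := mul_le_mul_of_nonneg_right hδ hH0
  have hfin : 0 ≤ (ε + r ^ 2) * (((m - 1) / r ^ 2 + 2 / γ / (ε + r ^ 2)
      - 2 * r * ψ / (ε + r ^ 2) - p'' / p - (m - 1) * ψ / r) * H
      - (d * r ^ κ / p * ((m - 1) / r ^ 2) + c / 4 * r ^ κ / (r ^ 2 * p)) * H
      - (N * r ^ (κ - 1)) ^ 2 * (1 / 4 + 1 / (4 * (d * r ^ κ / p))
      + ψ ^ 2 / (2 * (c / 4 * r ^ κ / (r ^ 2 * p)))
      + 1 / (2 * (c / 4 * r ^ κ / (r ^ 2 * p)) * r ^ 2))) := by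
    refine mul_nonneg hA'.le ?_
    have : c * r ^ κ / (r ^ 2 * p) * H = 2 * (c / 2 * r ^ κ / (r ^ 2 * p) * H) := by ring
    linarith
  have e2 : (ε + r ^ 2) * (2 / γ / (ε + r ^ 2)) = 2 / γ := by field_simp
  have e3 : (ε + r ^ 2) * (2 * r * ψ / (ε + r ^ 2)) = 2 * r * ψ := by field_simp
  have e4 : (m - 1) / r * ((ε + r ^ 2) * ψ * H) = (ε + r ^ 2) * ((m - 1) * ψ / r * H) := by
    ring
  rw [e4]
  generalize (N * r ^ (κ - 1)) ^ 2 * (1 / 4 + 1 / (4 * (d * r ^ κ / p))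
      + ψ ^ 2 / (2 * (c / 4 * r ^ κ / (r ^ 2 * p)))
      + 1 / (2 * (c / 4 * r ^ κ / (r ^ 2 * p)) * r ^ 2)) = X at *
  generalize 2 / γ / (ε + r ^ 2) = Y at *
  generalize 2 * r * ψ / (ε + r ^ 2) = W at *
  rw [← e2, ← e3]
  linarith

theorem le_of_isBarrier {m γ κ R₀ c Cφ Cκ CΘ : ℝ} (hm : 1 ≤ m) (hc : 0 < c)
    (hCφ : 0 < Cφ) (hCκ : 0 < Cκ) :
    ∃ C > 0, ∀ φ φ' φ'' Θ θ : ℝ → ℝ, IsBarrier m γ κ R₀ c Cφ Cκ CΘ φ φ' φ'' Θ θ →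
      ∀ ε ρ N B : ℝ, ∀ H H' Q q S : ℝ → ℝ, 0 < ε → 0 ≤ N → ρ ≤ R₀ →
      (∀ r ∈ Ioc 0 ρ, 0 ≤ H r) →
      (∀ r ∈ Ioc 0 ρ, HasDerivAt H (H' r) r) →
      (∀ r ∈ Ioc 0 ρ, HasDerivAt Q (S r + 2 / γ * H r - (m - 1) / r * Q r) r) →
      (∀ r ∈ Ioc 0 ρ, (ε + r ^ 2) * H' r = 2 * (Q r + q r)) →
      (∀ r ∈ Ioc 0 ρ, |q r| ≤ (ε + r ^ 2) * (N * r ^ (κ - 1)) * √(H r)) →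
      (∀ r ∈ Ioc 0 ρ, ∀ ψ δ μ : ℝ, 0 < δ → δ ≤ 1 → 0 < μ →
        (ε + r ^ 2) * (ψ * H' r - ψ ^ 2 * H r + (1 - δ) * ((m - 1) / r ^ 2 * H r) - μ * H r
          - (N * r ^ (κ - 1)) ^ 2 * (1 / 4 + 1 / (4 * δ) + ψ ^ 2 / (2 * μ) + 1 / (2 * μ * r ^ 2)))
          ≤ S r) →
      (∀ r ∈ Ioc 0 ρ, H r ≤ B * r ^ 2) → (∀ r ∈ Ioc 0 ρ, |Q r| ≤ B * r) →
      ∀ r ∈ Ioc 0 ρ, H r ≤ C * φ r ^ 2 * (H ρ / φ ρ ^ 2 + N ^ 2) := by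
  obtain ⟨d, hd, hdκ, hdm⟩ : ∃ d > 0, d * Cκ ≤ 1 ∧ (m - 1) * d ≤ c / 4 := by
    have hm0 : 0 < m := by linarith
    refine ⟨min (1 / Cκ) (c / (4 * m)), by positivity, ?_, ?_⟩
    · calc _ ≤ 1 / Cκ * Cκ := by gcongr; exact min_le_left _ _
        _ = 1 := by field_simp
    · calc _ ≤ (m - 1) * (c / (4 * m)) :=
            mul_le_mul_of_nonneg_left (min_le_right _ _) (by linarith)
        _ ≤ m * (c / (4 * m)) := by gcongr; linarith
        _ = c / 4 := by field_simp
  set C₁ := Cκ / 4 + 1 / (4 * d) + 2 * (Cφ ^ 2 + 1) / c with hC₁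
  have hC₁0 : 0 < C₁ := by positivity
  refine ⟨2 + 2 * (2 * C₁ / c) + 16 * CΘ ^ 2, by positivity, ?_⟩
  intro φ φ' φ'' Θ θ hB ε ρ N B H H' Q q S hε hN hρ hH0 hH hQ hHQ hq hS hHB hQB r₀ hr₀
  have hmem : ∀ r ∈ Ioc 0 ρ, r ∈ Ioc 0 R₀ := fun r hr => ⟨hr.1, hr.2.trans hρ⟩
  have hρ0 : 0 < ρ := hr₀.1.trans_le hr₀.2
  have hρm : ρ ∈ Ioc 0 ρ := ⟨hρ0, le_rfl⟩
  have hB0 : 0 ≤ B := by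
    have h1 := (abs_nonneg _).trans (hQB ρ hρm)
    exact nonneg_of_mul_nonneg_left h1 hρ0
  obtain ⟨L, hL⟩ := hB.linear_le
  have hφ : ∀ r ∈ Ioc 0 ρ, 0 < φ r := fun r hr => hB.pos r (hmem r hr)
  have hA : ∀ r : ℝ, 0 < ε + r ^ 2 := fun r => by positivity
  have hZ : ∀ r ∈ Ioc 0 ρ, HasDerivAt (fun r => H r / φ r ^ 2)
      (H' r / φ r ^ 2 - 2 * (φ' r / φ r) * (H r / φ r ^ 2)) r := by
    intro r hr
    have hp := (hφ r hr).ne'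
    refine ((hH r hr).div ((hB.hasDerivAt r (hmem r hr)).pow 2) (pow_ne_zero 2 hp)).congr_deriv ?_
    simp only [Nat.cast_ofNat, Nat.add_one_sub_one, pow_one, Pi.pow_apply]
    field_simp
  have hω : ContinuousOn (fun r => r ^ (m - 1) * (ε + r ^ 2) * φ r ^ 2) (Ioc 0 ρ) := by
    refine ((ContinuousOn.rpow_const continuousOn_id fun r hr => Or.inl hr.1.ne').mul
      (by fun_prop)).mul (ContinuousOn.pow ?_ 2)
    exact fun r hr => (hB.hasDerivAt r (hmem r hr)).continuousAt.continuousWithinAt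
  have hωpos : ∀ r ∈ Ioc 0 ρ, 0 < r ^ (m - 1) * (ε + r ^ 2) * φ r ^ 2 := fun r hr => by
    have := hφ r hr; have := hA r; have := Real.rpow_pos_of_pos hr.1 (m - 1); positivity
  have hJ : ∀ r ∈ Ioc 0 ρ, HasDerivAt
      (fun r => 2 * r ^ (m - 1) * (Q r - (ε + r ^ 2) * (φ' r / φ r) * H r))
      (2 * r ^ (m - 1) * (S r + 2 / γ * H r - (m - 1) / r * ((ε + r ^ 2) * (φ' r / φ r) * H r)
        - (2 * r * (φ' r / φ r) * H r
          + (ε + r ^ 2) * (φ'' r / φ r - (φ' r / φ r) ^ 2) * H r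
          + (ε + r ^ 2) * (φ' r / φ r) * H' r))) r := by
    intro r hr
    have hp := (hφ r hr).ne'
    have hr0 := hr.1.ne'
    have h1 : HasDerivAt (fun r : ℝ => 2 * r ^ (m - 1)) (2 * ((m - 1) * r ^ (m - 1 - 1))) r :=
      (Real.hasDerivAt_rpow_const (Or.inl hr0)).const_mul 2
    have h2 : HasDerivAt (fun r : ℝ => ε + r ^ 2) (2 * r) r := by
      simpa using (hasDerivAt_pow 2 r).const_add ε
    have h3 := (hB.hasDerivAt' r (hmem r hr)).div (hB.hasDerivAt r (hmem r hr)) hp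
    refine (h1.mul ((hQ r hr).sub ((h2.mul h3).mul (hH r hr)))).congr_deriv ?_
    rw [Real.rpow_sub_one hr0 (m - 1)]
    simp only [Pi.mul_apply, Pi.div_apply, Pi.sub_apply]
    field_simp
    ring
  have hψ : ∀ r ∈ Ioc 0 ρ, |φ' r / φ r| ≤ Cφ / r := by
    intro r hr
    have h := hB.deriv_le r (hmem r hr)
    rw [abs_mul, abs_of_pos hr.1] at h
    rw [abs_div, abs_of_pos (hφ r hr), div_le_div_iff₀ (hφ r hr) hr.1]
    linarith
  have hZ0 : ∀ r ∈ Ioc 0 ρ, 0 ≤ H r / φ r ^ 2 := fun r hr => div_nonneg (hH0 r hr) (sq_nonneg _)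
  have main := le_of_flux (ρ := ρ) (Z := fun r => H r / φ r ^ 2)
    (ω := fun r => r ^ (m - 1) * (ε + r ^ 2) * φ r ^ 2) (Θ := Θ) (θ := θ)
    (K := 2 * C₁ / c * N ^ 2) (N := N) (c := CΘ) (b := B * L ^ 2) hω hωpos hZ hZ0 ?_ hJ
    (fun r hr => hB.hasDerivAt_weight r (hmem r hr)) ?_
    (fun r hr => hB.weight_mem r (hmem r hr)) hN (by positivity) ?_ ?_ ?_ r₀ hr₀
  · have := hφ r₀ hr₀
    rw [div_le_iff₀ (by positivity)] at main
    refine main.trans ?_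
    have h1 := hZ0 ρ hρm
    have h2 : 0 ≤ φ r₀ ^ 2 := by positivity
    have h3 : 0 ≤ N ^ 2 := by positivity
    have h4 : 0 ≤ C₁ / c := by positivity
    have h5 : 2 * (H ρ / φ ρ ^ 2 + 2 * C₁ / c * N ^ 2) + 16 * CΘ ^ 2 * N ^ 2
      ≤ (2 + 2 * (2 * C₁ / c) + 16 * CΘ ^ 2) * (H ρ / φ ρ ^ 2 + N ^ 2) := by
      have : 0 ≤ (2 * (2 * C₁ / c) + 16 * CΘ ^ 2) * (H ρ / φ ρ ^ 2) := by positivity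
      linarith
    nlinarith [mul_le_mul_of_nonneg_right h5 h2]
  · intro r hr
    have := hφ r hr
    rw [div_le_iff₀ (by positivity)]
    refine (hHB r hr).trans ?_
    have := pow_le_pow_left₀ hr.1.le (hL r (hmem r hr)) 2
    nlinarith
  · intro r hr
    refine le_trans ?_ (hB.le_weight r (hmem r hr))
    have := hφ r hr
    have := Real.rpow_pos_of_pos hr.1 κ
    have := hr.1
    positivity
  · intro r hr
    have hp := hφ r hr
    have hA' := hA r
    have hr0 := hr.1
    have hrm := Real.rpow_pos_of_pos hr.1 (m - 1)
    have e : H' r / φ r ^ 2 - 2 * (φ' r / φ r) * (H r / φ r ^ 2)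
        - 2 * r ^ (m - 1) * (Q r - (ε + r ^ 2) * (φ' r / φ r) * H r)
          / (r ^ (m - 1) * (ε + r ^ 2) * φ r ^ 2) = 2 * q r / ((ε + r ^ 2) * φ r ^ 2) := by
      have : H' r = 2 * (Q r + q r) / (ε + r ^ 2) := by
        rw [eq_div_iff hA'.ne', ← hHQ r hr]; ring
      rw [this]
      field_simp
      ring
    rw [e, abs_div, abs_mul, abs_two, abs_of_pos (by positivity : 0 < (ε + r ^ 2) * φ r ^ 2)]
    have hs : √(H r / φ r ^ 2) = √(H r) / φ r := by
      rw [Real.sqrt_div (hH0 r hr), Real.sqrt_sq hp.le]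
    calc 2 * |q r| / ((ε + r ^ 2) * φ r ^ 2)
        ≤ 2 * ((ε + r ^ 2) * (N * r ^ (κ - 1)) * √(H r)) / ((ε + r ^ 2) * φ r ^ 2) := by
          gcongr; exact hq r hr
      _ = 2 * N * √(H r / φ r ^ 2) * (r ^ κ / (r * φ r)) := by
          rw [hs, Real.rpow_sub_one hr.1.ne']; field_simp
      _ ≤ _ := by
          have := hB.le_weight r (hmem r hr)
          gcongr
  · intro r hr hK
    have hrm := Real.rpow_pos_of_pos hr.1 (m - 1)
    have hr0 := hr.1
    exact mul_nonneg (by positivity) (flux_deriv_nonneg hc hd hdκ hdm hε hr.1 (hφ r hr)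
      (hH0 r hr) (hB.super r (hmem r hr) (r ^ 2 / (ε + r ^ 2)) ⟨by have := hA r; positivity, by
        rw [div_le_one (hA r)]; linarith⟩) (hB.rpow_le r (hmem r hr)) (hψ r hr) (hS r hr) hK)
  · have hbound : ∀ r ∈ Ioc 0 ρ,
        |2 * r ^ (m - 1) * (Q r - (ε + r ^ 2) * (φ' r / φ r) * H r)|
          ≤ 2 * ρ ^ (m - 1) * (B + (ε + ρ ^ 2) * (Cφ * B)) * r := by
      intro r hr
      have hr0 := hr.1
      have h1 : r ^ (m - 1) ≤ ρ ^ (m - 1) := Real.rpow_le_rpow hr.1.le hr.2 (by linarith)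
      have h0 := Real.rpow_pos_of_pos hr.1 (m - 1)
      have h2 : |Q r - (ε + r ^ 2) * (φ' r / φ r) * H r| ≤ (B + (ε + ρ ^ 2) * (Cφ * B)) * r := by
        refine (abs_sub _ _).trans ?_
        rw [abs_mul, abs_mul, abs_of_pos (hA r), abs_of_nonneg (hH0 r hr), add_mul B]
        refine add_le_add (hQB r hr) ?_
        have := hψ r hr
        have := hHB r hr
        have := hH0 r hr
        have hρ2 : r ^ 2 ≤ ρ ^ 2 := pow_le_pow_left₀ hr.1.le hr.2 2
        calc (ε + r ^ 2) * |φ' r / φ r| * H r ≤ (ε + ρ ^ 2) * (Cφ / r) * (B * r ^ 2) := by gcongr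
          _ = _ := by field_simp
      rw [abs_mul, abs_of_pos (by positivity : 0 < 2 * r ^ (m - 1)), mul_assoc (2 * ρ ^ (m - 1))]
      gcongr
    have hlim : Tendsto (fun r : ℝ => 2 * ρ ^ (m - 1) * (B + (ε + ρ ^ 2) * (Cφ * B)) * r)
        (𝓝[>] 0) (𝓝 0) := by
      have : Tendsto (fun r : ℝ => 2 * ρ ^ (m - 1) * (B + (ε + ρ ^ 2) * (Cφ * B)) * r)
        (𝓝 0) (𝓝 (2 * ρ ^ (m - 1) * (B + (ε + ρ ^ 2) * (Cφ * B)) * 0)) :=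
        (continuous_const.mul continuous_id).tendsto 0
      rw [mul_zero] at this
      exact this.mono_left nhdsWithin_le_nhds
    refine squeeze_zero_norm' ?_ hlim
    filter_upwards [Ioc_mem_nhdsGT hρ0] with r hr using hbound r hr

/-- Differentiation under the integral sign over a compact space. -/
theorem hasDerivAt_integral_compact {X : Type*} [TopologicalSpace X] [CompactSpace X]
    [MeasurableSpace X] [BorelSpace X] (P : Measure X) [IsFiniteMeasure P]
    {Φ Φ' : ℝ → X → ℝ} {s : Set ℝ} {r : ℝ} (hs : s ∈ 𝓝 r)
    (hc : ∀ t ∈ s, Continuous (Φ t))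
    (hd : ∀ t ∈ s, ∀ x, HasDerivAt (fun t => Φ t x) (Φ' t x) t)
    (hc' : ContinuousOn (fun p : ℝ × X => Φ' p.1 p.2) (s ×ˢ univ)) :
    HasDerivAt (fun t => ∫ x, Φ t x ∂P) (∫ x, Φ' r x ∂P) r := by
  obtain ⟨δ, hδ, hsub⟩ := Metric.nhds_basis_closedBall.mem_iff.1 hs
  have hK : IsCompact (closedBall r δ ×ˢ (univ : Set X)) :=
    (isCompact_closedBall r δ).prod isCompact_univ
  obtain ⟨C, hC⟩ := hK.exists_bound_of_continuousOn (hc'.mono (prod_mono hsub subset_rfl))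
  have hr : r ∈ s := mem_of_mem_nhds hs
  have hcr : Continuous (Φ' r) := by
    have : ContinuousOn (fun x : X => Φ' r x) univ :=
      hc'.comp (f := fun x : X => (r, x)) (by fun_prop) (fun x _ => ⟨hr, mem_univ x⟩)
    exact continuousOn_univ.1 this
  refine (hasDerivAt_integral_of_dominated_loc_of_deriv_le (F := Φ) (F' := Φ') (bound := fun _ => C)
    (closedBall_mem_nhds r hδ) ?_ ?_ ?_ ?_ ?_ ?_).2
  · filter_upwards [hs] with t ht using (hc t ht).aestronglyMeasurable
  · exact (hc r hr).integrable_of_hasCompactSupport (HasCompactSupport.of_compactSpace _)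
  · exact hcr.aestronglyMeasurable
  · exact Eventually.of_forall fun x t ht => hC (t, x) ⟨ht, mem_univ x⟩
  · exact integrable_const C
  · exact Eventually.of_forall fun x t ht => hd t (hsub ht) x

/-- A probability measure on the unit sphere that is invariant under linear isometries. -/
structure IsRotInv {m : ℕ} (P : Measure (sphere (0 : E m) 1)) : Prop where
  isProb : IsProbabilityMeasure P
  integral_comp : ∀ (L : E m ≃ₗᵢ[ℝ] E m) (f : E m → ℝ), ∫ θ, f (L θ) ∂P = ∫ θ, f θ ∂P

section
variable {m : ℕ} {P : Measure (sphere (0 : E m) 1)}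

theorem norm_sphere_eq (θ : sphere (0 : E m) 1) : ‖(θ : E m)‖ = 1 := by
  simp

theorem smul_sphere_mem_ball {r R₀ : ℝ} (hr : r ∈ Ioo (-R₀) R₀) (θ : sphere (0 : E m) 1) :
    r • (θ : E m) ∈ ball (0 : E m) R₀ := by
  rw [mem_ball_zero_iff, norm_smul, norm_sphere_eq, mul_one, Real.norm_eq_abs]
  exact abs_lt.2 hr

theorem continuous_comp_smul_sphere {F : Type*} [TopologicalSpace F] {R₀ r : ℝ} {f : E m → F}
    (hf : ContinuousOn f (ball 0 R₀)) (hr : r ∈ Ioo (-R₀) R₀) :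
    Continuous fun θ : sphere (0 : E m) 1 => f (r • (θ : E m)) :=
  hf.comp_continuous (by fun_prop) fun θ => smul_sphere_mem_ball hr θ

theorem integrable_sphere [IsFiniteMeasure P] {f : sphere (0 : E m) 1 → ℝ} (hf : Continuous f) :
    Integrable f P :=
  hf.integrable_of_hasCompactSupport (HasCompactSupport.of_compactSpace _)

/-- Reflection in the hyperplane orthogonal to `u`. -/
noncomputable def hypRefl (u : E m) : E m ≃ₗᵢ[ℝ] E m := (ℝ ∙ u)ᗮ.reflection

theorem hypRefl_apply {u : E m} (hu : ‖u‖ = 1) (y : E m) : hypRefl u y = y - (2 * ⟪u, y⟫) • u := by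
  rw [hypRefl, Submodule.reflection_orthogonal_apply, Submodule.reflection_singleton_apply]
  simp only [hu, RCLike.ofReal_real_eq_id, id, one_pow, div_one]
  module

theorem hypRefl_hypRefl (u y : E m) : hypRefl u (hypRefl u y) = y := by
  simp [hypRefl]

theorem inner_hypRefl_self {u : E m} (hu : ‖u‖ = 1) (y : E m) : ⟪u, hypRefl u y⟫ = -⟪u, y⟫ := by
  rw [hypRefl_apply hu, inner_sub_right, inner_smul_right, real_inner_self_eq_norm_sq, hu]; ring

set_option maxHeartbeats 400000 in
/-- Derivatives along rotation fields have zero spherical mean. -/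
theorem integral_fderiv_rotation (hP : IsRotInv P) {R₀ r : ℝ} (hr : r ∈ Ioo 0 R₀) {f : E m → ℝ}
    (hf : ContDiffOn ℝ 1 f (ball 0 R₀)) {a b : E m} (ha : ‖a‖ = 1) (hb : ‖b‖ = 1)
    (hab : ⟪a, b⟫ = 0) :
    ∫ θ : sphere (0 : E m) 1, fderiv ℝ f (r • (θ : E m)) (⟪b, (θ : E m)⟫ • a - ⟪a, (θ : E m)⟫ • b) ∂P
      = 0 := by
  have := hP.isProb
  have hrm : r ∈ Ioo (-R₀) R₀ := ⟨by linarith [hr.1, hr.2], hr.2⟩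
  set u : ℝ → E m := fun t => Real.cos t • a + Real.sin t • b with hu
  set v : ℝ → E m := fun t => (-Real.sin t) • a + Real.cos t • b with hv
  have hud : ∀ t, HasDerivAt u (v t) t := fun t =>
    ((Real.hasDerivAt_cos t).smul_const a).add ((Real.hasDerivAt_sin t).smul_const b)
  have hu1 : ∀ t, ‖u t‖ = 1 := fun t => by
    have : ‖u t‖ ^ 2 = 1 := by
      rw [← real_inner_self_eq_norm_sq]
      simp only [hu, inner_add_left, inner_add_right, inner_smul_left, inner_smul_right,
        real_inner_self_eq_norm_sq, ha, hb, hab, real_inner_comm a b]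
      simp
      nlinarith [Real.sin_sq_add_cos_sq t]
    nlinarith [norm_nonneg (u t)]
  have huc : Continuous u := by fun_prop
  have hvc : Continuous v := by fun_prop
  have hsm : ∀ t, ∀ θ : sphere (0 : E m) 1, r • hypRefl (u t) θ ∈ ball (0 : E m) R₀ := fun t θ => by
    rw [mem_ball_zero_iff, norm_smul, LinearIsometryEquiv.norm_map, norm_sphere_eq, mul_one,
      Real.norm_eq_abs]
    exact abs_lt.2 hrm
  have hrc : Continuous fun p : ℝ × sphere (0 : E m) 1 => r • hypRefl (u p.1) (p.2 : E m) := by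
    simp only [hypRefl_apply (hu1 _)]
    fun_prop
  have hfc : ContinuousOn (fderiv ℝ f) (ball 0 R₀) :=
    hf.continuousOn_fderiv_of_isOpen isOpen_ball le_rfl
  have hd := hasDerivAt_integral_compact P (s := univ) (r := 0)
    (Φ := fun t θ => f (r • hypRefl (u t) θ))
    (Φ' := fun t θ => fderiv ℝ f (r • hypRefl (u t) θ)
      (r • (-((2 * ⟪v t, (θ : E m)⟫) • u t + (2 * ⟪u t, (θ : E m)⟫) • v t))))
    univ_mem ?_ ?_ ?_
  · have hconst : (fun t => ∫ θ : sphere (0 : E m) 1, f (r • hypRefl (u t) θ) ∂P)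
        = fun _ => ∫ θ : sphere (0 : E m) 1, f (r • (θ : E m)) ∂P := by
      funext t
      exact hP.integral_comp (hypRefl (u t)) (fun y => f (r • y))
    rw [hconst] at hd
    have h0 := hd.unique (hasDerivAt_const _ _)
    have hu0 : u 0 = a := by simp [hu]
    have hv0 : v 0 = b := by simp [hv]
    simp only [hu0, hv0] at h0
    have h1 := hP.integral_comp (hypRefl a) (fun y => fderiv ℝ f (r • hypRefl a y)
      (r • (-((2 * ⟪b, y⟫) • a + (2 * ⟪a, y⟫) • b))))
    rw [h0] at h1
    have h2 : ∀ y : E m, fderiv ℝ f (r • hypRefl a (hypRefl a y))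
        (r • (-((2 * ⟪b, hypRefl a y⟫) • a + (2 * ⟪a, hypRefl a y⟫) • b)))
        = (-2 * r) * fderiv ℝ f (r • y) (⟪b, y⟫ • a - ⟪a, y⟫ • b) := by
      intro y
      have hby : ⟪b, hypRefl a y⟫ = ⟪b, y⟫ := by
        rw [hypRefl_apply ha, inner_sub_right, inner_smul_right, (real_inner_comm a b).trans hab]
        simp
      rw [hypRefl_hypRefl, hby, inner_hypRefl_self ha, ← smul_eq_mul (-2 * r), ← map_smul]
      congr 1
      module
    simp only [h2] at h1
    rw [integral_const_mul] at h1
    rcases mul_eq_zero.1 h1 with h | h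
    · linarith [hr.1]
    · exact h
  · intro t _
    exact hf.continuousOn.comp_continuous
      (((hypRefl (u t)).continuous.comp continuous_subtype_val).const_smul r) (hsm t)
  · intro t _ θ
    have h1 : HasDerivAt (fun t => r • hypRefl (u t) (θ : E m))
        (r • (-((2 * ⟪v t, (θ : E m)⟫) • u t + (2 * ⟪u t, (θ : E m)⟫) • v t))) t := by
      simp only [hypRefl_apply (hu1 _)]
      have h2 : HasDerivAt (fun t => 2 * ⟪u t, (θ : E m)⟫) (2 * ⟪v t, (θ : E m)⟫) t := by
        have := ((hud t).inner ℝ (hasDerivAt_const t (θ : E m))).const_mul 2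
        simpa using this
      have h3 : HasDerivAt (fun t => r • ((θ : E m) - (2 * ⟪u t, (θ : E m)⟫) • u t))
          (r • (-((2 * ⟪u t, (θ : E m)⟫) • v t + (2 * ⟪v t, (θ : E m)⟫) • u t))) t :=
        ((h2.smul (hud t)).const_sub (θ : E m)).const_smul r
      rw [add_comm]
      exact h3
    have h4 : DifferentiableAt ℝ f (r • hypRefl (u t) (θ : E m)) :=
      (hf.differentiableOn one_ne_zero).differentiableAt (isOpen_ball.mem_nhds (hsm t θ))
    exact HasFDerivAt.comp_hasDerivAt t h4.hasFDerivAt h1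
  · refine ContinuousOn.clm_apply (hfc.comp hrc.continuousOn fun p _ => hsm p.1 p.2) ?_
    exact Continuous.continuousOn (by fun_prop)

theorem sum_coord_smul_single (y : E m) : ∑ i, y i • EuclideanSpace.single i (1 : ℝ) = y := by
  ext j
  simp [Pi.single_apply]

/-- The spherical form of the divergence theorem. -/
theorem integral_divg_sphere (hP : IsRotInv P) {R₀ r : ℝ} (hr : r ∈ Ioo 0 R₀) {V : E m → E m}
    (hV : ContDiffOn ℝ 1 V (ball 0 R₀)) :
    ∫ θ : sphere (0 : E m) 1, (r * divg V (r • (θ : E m)) - ((m : ℝ) - 1) * ⟪V (r • (θ : E m)), θ⟫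
      - r * ⟪fderiv ℝ V (r • (θ : E m)) θ, θ⟫) ∂P = 0 := by
  have := hP.isProb
  have hrm : r ∈ Ioo (-R₀) R₀ := ⟨by linarith [hr.1, hr.2], hr.2⟩
  set e : Fin m → E m := fun i => EuclideanSpace.single i (1 : ℝ) with he
  have hcoord : ∀ i, ContDiff ℝ 1 fun y : E m => y i := fun i =>
    (EuclideanSpace.proj i : E m →L[ℝ] ℝ).contDiff
  have hf : ∀ i j, ContDiffOn ℝ 1 (fun y : E m => y i * V y j) (ball 0 R₀) := fun i j =>
    (hcoord i).contDiffOn.mul ((hcoord j).comp_contDiffOn hV)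
  have hVd : ∀ θ : sphere (0 : E m) 1, DifferentiableAt ℝ V (r • (θ : E m)) := fun θ =>
    (hV.differentiableOn one_ne_zero).differentiableAt
      (isOpen_ball.mem_nhds (smul_sphere_mem_ball hrm θ))
  have hfd : ∀ i j, ∀ θ : sphere (0 : E m) 1, ∀ h : E m,
      fderiv ℝ (fun y : E m => y i * V y j) (r • (θ : E m)) h
        = h i * V (r • (θ : E m)) j + r * (θ : E m) i * (fderiv ℝ V (r • (θ : E m)) h) j := by
    intro i j θ h
    have h1 : HasFDerivAt (fun y : E m => y i)
        (EuclideanSpace.proj i : E m →L[ℝ] ℝ) (r • (θ : E m)) :=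
      (EuclideanSpace.proj i : E m →L[ℝ] ℝ).hasFDerivAt
    have h2 : HasFDerivAt (fun y : E m => V y j)
        ((EuclideanSpace.proj j : E m →L[ℝ] ℝ).comp
          (fderiv ℝ V (r • (θ : E m)))) (r • (θ : E m)) :=
      (EuclideanSpace.proj j : E m →L[ℝ] ℝ).hasFDerivAt.comp _
        (hVd θ).hasFDerivAt
    rw [(h1.fun_mul h2).fderiv]
    simp
    ring
  set T : Fin m → Fin m → sphere (0 : E m) 1 → ℝ := fun i j θ =>
    fderiv ℝ (fun y : E m => y i * V y j) (r • (θ : E m))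
      (⟪e i, (θ : E m)⟫ • e j - ⟪e j, (θ : E m)⟫ • e i) with hT
  have hTc : ∀ i j, Continuous (T i j) := fun i j =>
    (continuous_comp_smul_sphere ((hf i j).continuousOn_fderiv_of_isOpen isOpen_ball le_rfl)
      hrm).clm_apply (by fun_prop)
  have hT0 : ∀ i j, ∫ θ, T i j θ ∂P = 0 := by
    intro i j
    by_cases hij : i = j
    · subst hij; simp [hT]
    · exact integral_fderiv_rotation hP hr (hf i j) (by simp [he]) (by simp [he])
        (by simp [he, EuclideanSpace.inner_single_left, Ne.symm hij])
  have hsum : ∫ θ, ∑ i, ∑ j, T i j θ ∂P = 0 := by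
    rw [integral_finsetSum _ fun i _ => integrable_finsetSum _ fun j _ =>
      integrable_sphere (hTc i j)]
    refine Finset.sum_eq_zero fun i _ => ?_
    rw [integral_finsetSum _ fun j _ => integrable_sphere (hTc i j)]
    exact Finset.sum_eq_zero fun j _ => hT0 i j
  rw [← hsum]
  refine integral_congr_ae (Eventually.of_forall fun θ => ?_)
  set D := fderiv ℝ V (r • (θ : E m))
  have hin : ∀ i, ⟪e i, (θ : E m)⟫ = (θ : E m) i := fun i => by
    simp [he, EuclideanSpace.inner_single_left]
  have hθ : ∑ i, (θ : E m) i * (θ : E m) i = 1 := by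
    have := real_inner_self_eq_norm_sq (θ : E m)
    rw [norm_sphere_eq, PiLp.inner_apply] at this
    simpa [sq] using this
  have hD : D θ = ∑ i, (θ : E m) i • D (e i) := by
    conv_lhs => rw [← sum_coord_smul_single (θ : E m)]
    simp [he]
  have hTij : ∀ i j, T i j θ = (if i = j then (θ : E m) i * V (r • (θ : E m)) j else 0)
      - (θ : E m) j * V (r • (θ : E m)) j
      + r * ((θ : E m) i * (θ : E m) i * (D (e j)) j) - r * ((θ : E m) i * (D (e i)) j * (θ : E m) j) := by
    intro i j
    simp only [hT, hfd, hin]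
    have : (e j) i = if i = j then 1 else 0 := by simp [he]
    have h' : (e i) i = 1 := by simp [he]
    simp [map_sub, this, h']
    split_ifs <;> ring
  simp only [hTij, Finset.sum_sub_distrib, Finset.sum_add_distrib]
  have hdiv : divg V (r • (θ : E m)) = ∑ j, (D (e j)) j := rfl
  have hVθ : ⟪V (r • (θ : E m)), (θ : E m)⟫ = ∑ j, (θ : E m) j * V (r • (θ : E m)) j := by
    rw [PiLp.inner_apply]; simp
  have hDθ : ⟪D θ, (θ : E m)⟫ = ∑ i, ∑ j, (θ : E m) i * (D (e i)) j * (θ : E m) j := by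
    rw [hD, sum_inner]
    refine Finset.sum_congr rfl fun i _ => ?_
    rw [PiLp.inner_apply]
    refine Finset.sum_congr rfl fun j _ => ?_
    simp
    ring
  have h3 : ∑ i, ∑ j, r * ((θ : E m) i * (θ : E m) i * (D (e j)) j) = r * divg V (r • (θ : E m)) := by
    rw [hdiv]
    simp_rw [← Finset.mul_sum]
    rw [← Finset.sum_mul, hθ, one_mul]
  rw [h3, hVθ, hDθ]
  simp only [Finset.mul_sum, Finset.sum_ite_eq, Finset.mem_univ, if_true, Finset.sum_const,
    Finset.card_univ, Fintype.card_fin, nsmul_eq_mul]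
  simp only [sub_mul, one_mul, Finset.sum_sub_distrib]
  ring

theorem continuousOn_divg {R₀ : ℝ} {V : E m → E m} (hV : ContDiffOn ℝ 1 V (ball 0 R₀)) :
    ContinuousOn (divg V) (ball 0 R₀) := by
  have h := hV.continuousOn_fderiv_of_isOpen isOpen_ball le_rfl
  unfold divg
  refine continuousOn_finsetSum _ fun i _ => ?_
  exact (EuclideanSpace.proj i : E m →L[ℝ] ℝ).continuous.comp_continuousOn
    (h.clm_apply continuousOn_const)

theorem continuousOn_gradient {R₀ : ℝ} {w : E m → ℝ} (hw : ContDiffOn ℝ 1 w (ball 0 R₀)) :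
    ContinuousOn (gradient w) (ball 0 R₀) :=
  (InnerProductSpace.toDual ℝ (E m)).symm.continuous.comp_continuousOn
    (hw.continuousOn_fderiv_of_isOpen isOpen_ball le_rfl)

theorem fderiv_eq_inner_gradient (w : E m → ℝ) (y h : E m) : fderiv ℝ w y h = ⟪gradient w y, h⟫ := by
  rw [gradient, InnerProductSpace.toDual_symm_apply]

theorem hasDerivAt_integral_radial (hP : IsRotInv P) {R₀ r : ℝ} (hr : r ∈ Ioo 0 R₀) {w : E m → ℝ}
    (hw : ContDiffOn ℝ 1 w (ball 0 R₀)) :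
    HasDerivAt (fun r => ∫ θ : sphere (0 : E m) 1, w (r • (θ : E m)) ∂P)
      (∫ θ : sphere (0 : E m) 1, ⟪gradient w (r • (θ : E m)), (θ : E m)⟫ ∂P) r := by
  have := hP.isProb
  have hsub : ∀ t ∈ Ioo 0 R₀, t ∈ Ioo (-R₀) R₀ := fun t ht => ⟨by linarith [ht.1, ht.2], ht.2⟩
  refine hasDerivAt_integral_compact P (s := Ioo 0 R₀)
    (Φ := fun t θ => w (t • (θ : E m)))
    (Φ' := fun t θ => ⟪gradient w (t • (θ : E m)), (θ : E m)⟫) (Ioo_mem_nhds hr.1 hr.2) ?_ ?_ ?_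
  · exact fun t ht => continuous_comp_smul_sphere hw.continuousOn (hsub t ht)
  · intro t ht θ
    have h1 : HasDerivAt (fun t : ℝ => t • (θ : E m)) (θ : E m) t := by
      simpa using (hasDerivAt_id t).smul_const (θ : E m)
    have h2 : DifferentiableAt ℝ w (t • (θ : E m)) :=
      (hw.differentiableOn one_ne_zero).differentiableAt
        (isOpen_ball.mem_nhds (smul_sphere_mem_ball (hsub t ht) θ))
    rw [← fderiv_eq_inner_gradient]
    exact HasFDerivAt.comp_hasDerivAt t h2.hasFDerivAt h1
  · have h1 : Continuous fun p : ℝ × sphere (0 : E m) 1 => p.1 • (p.2 : E m) := by fun_prop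
    have h2 : Continuous fun p : ℝ × sphere (0 : E m) 1 => (p.2 : E m) := by fun_prop
    exact ((continuousOn_gradient hw).comp h1.continuousOn
      fun p hp => smul_sphere_mem_ball (hsub p.1 hp.1) p.2).inner h2.continuousOn

/-- The derivative in the radius of the flux of a vector field through spheres. -/
theorem hasDerivAt_integral_flux (hP : IsRotInv P) {R₀ r : ℝ} (hr : r ∈ Ioo 0 R₀) {V : E m → E m}
    (hV : ContDiffOn ℝ 1 V (ball 0 R₀)) :
    HasDerivAt (fun r => ∫ θ : sphere (0 : E m) 1, ⟪V (r • (θ : E m)), (θ : E m)⟫ ∂P)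
      (∫ θ : sphere (0 : E m) 1, divg V (r • (θ : E m)) ∂P
        - ((m : ℝ) - 1) / r * ∫ θ : sphere (0 : E m) 1, ⟪V (r • (θ : E m)), (θ : E m)⟫ ∂P) r := by
  have := hP.isProb
  have hsub : ∀ t ∈ Ioo 0 R₀, t ∈ Ioo (-R₀) R₀ := fun t ht => ⟨by linarith [ht.1, ht.2], ht.2⟩
  have hfc := hV.continuousOn_fderiv_of_isOpen isOpen_ball le_rfl
  have h := hasDerivAt_integral_compact P (s := Ioo 0 R₀)
    (Φ := fun t θ => ⟪V (t • (θ : E m)), (θ : E m)⟫)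
    (Φ' := fun t θ => ⟪fderiv ℝ V (t • (θ : E m)) θ, (θ : E m)⟫) (Ioo_mem_nhds hr.1 hr.2) ?_ ?_ ?_
  · refine h.congr_deriv ?_
    have c1 : Continuous fun θ : sphere (0 : E m) 1 => divg V (r • (θ : E m)) :=
      continuous_comp_smul_sphere (continuousOn_divg hV) (hsub r hr)
    have c2 : Continuous fun θ : sphere (0 : E m) 1 => ⟪V (r • (θ : E m)), (θ : E m)⟫ :=
      (continuous_comp_smul_sphere hV.continuousOn (hsub r hr)).inner continuous_subtype_val
    have c3 : Continuous fun θ : sphere (0 : E m) 1 =>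
        ⟪fderiv ℝ V (r • (θ : E m)) θ, (θ : E m)⟫ :=
      ((continuous_comp_smul_sphere hfc (hsub r hr)).clm_apply continuous_subtype_val).inner
        continuous_subtype_val
    have key := integral_divg_sphere hP hr hV
    have i1 : Integrable (fun θ : sphere (0 : E m) 1 => r * divg V (r • (θ : E m))) P :=
      (integrable_sphere c1).const_mul r
    have i2 : Integrable (fun θ : sphere (0 : E m) 1 =>
        ((m : ℝ) - 1) * ⟪V (r • (θ : E m)), (θ : E m)⟫) P := (integrable_sphere c2).const_mul _
    have i3 : Integrable (fun θ : sphere (0 : E m) 1 =>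
        r * ⟪fderiv ℝ V (r • (θ : E m)) θ, (θ : E m)⟫) P := (integrable_sphere c3).const_mul r
    have i12 : Integrable (fun θ : sphere (0 : E m) 1 => r * divg V (r • (θ : E m)) -
        ((m : ℝ) - 1) * ⟪V (r • (θ : E m)), (θ : E m)⟫) P := i1.sub i2
    rw [integral_sub i12 i3, integral_sub i1 i2, integral_const_mul, integral_const_mul,
      integral_const_mul] at key
    have hr0 := hr.1.ne'
    field_simp
    linarith
  · exact fun t ht => (continuous_comp_smul_sphere hV.continuousOn (hsub t ht)).inner
      continuous_subtype_val
  · intro t ht θ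
    have h1 : HasDerivAt (fun t : ℝ => t • (θ : E m)) (θ : E m) t := by
      simpa using (hasDerivAt_id t).smul_const (θ : E m)
    have h2 : DifferentiableAt ℝ V (t • (θ : E m)) :=
      (hV.differentiableOn one_ne_zero).differentiableAt
        (isOpen_ball.mem_nhds (smul_sphere_mem_ball (hsub t ht) θ))
    have h3 : HasDerivAt (fun t : ℝ => V (t • (θ : E m))) (fderiv ℝ V (t • (θ : E m)) θ) t :=
      HasFDerivAt.comp_hasDerivAt t h2.hasFDerivAt h1
    simpa using h3.inner ℝ (hasDerivAt_const t (θ : E m))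
  · have h1 : Continuous fun p : ℝ × sphere (0 : E m) 1 => p.1 • (p.2 : E m) := by fun_prop
    have h2 : Continuous fun p : ℝ × sphere (0 : E m) 1 => (p.2 : E m) := by fun_prop
    exact ((hfc.comp h1.continuousOn
      fun p hp => smul_sphere_mem_ball (hsub p.1 hp.1) p.2).clm_apply h2.continuousOn).inner
        h2.continuousOn

theorem abs_le_of_odd {R₀ r C : ℝ} (hr : r ∈ Ioo 0 R₀) {w : E m → ℝ}
    (hw : ContDiffOn ℝ 1 w (ball 0 R₀)) (hC : ∀ y ∈ closedBall (0 : E m) r, ‖gradient w y‖ ≤ C)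
    {e : E m} (he : ‖e‖ = 1) (hodd : ∀ y, w (hypRefl e y) = -w y) {y : E m}
    (hy : y ∈ closedBall (0 : E m) r) : |w y| ≤ C * |⟪e, y⟫| := by
  have hy' : hypRefl e y ∈ closedBall (0 : E m) r := by
    rw [mem_closedBall_zero_iff, LinearIsometryEquiv.norm_map]
    exact mem_closedBall_zero_iff.1 hy
  have h := (convex_closedBall (0 : E m) r).norm_image_sub_le_of_norm_fderiv_le (𝕜 := ℝ) (f := w)
    (C := C) (fun x hx => (hw.differentiableOn one_ne_zero).differentiableAt
      (isOpen_ball.mem_nhds (closedBall_subset_ball hr.2 hx)))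
    (fun x hx => by
      have : ‖fderiv ℝ w x‖ = ‖gradient w x‖ := by
        rw [gradient, LinearIsometryEquiv.norm_map]
      rw [this]; exact hC x hx) hy' hy
  rw [hodd, hypRefl_apply he, sub_neg_eq_add, sub_sub_cancel, norm_smul, he, Real.norm_eq_abs,
    Real.norm_eq_abs, ← two_mul, abs_mul, abs_mul, abs_two] at h
  linarith

theorem divg_smul {f : E m → ℝ} {U : E m → E m} {y : E m} (hf : DifferentiableAt ℝ f y)
    (hU : DifferentiableAt ℝ U y) :
    divg (fun z => f z • U z) y = ⟪gradient f y, U y⟫ + f y * divg U y := by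
  have h : fderiv ℝ (fun z => f z • U z) y = f y • fderiv ℝ U y + (fderiv ℝ f y).smulRight (U y) :=
    (hf.hasFDerivAt.smul hU.hasFDerivAt).fderiv
  have h2 : fderiv ℝ f y (U y) = ∑ i, U y i * fderiv ℝ f y (EuclideanSpace.single i 1) := by
    conv_lhs => rw [← sum_coord_smul_single (U y)]
    simp [map_sum]
  rw [← fderiv_eq_inner_gradient, h2, divg, divg, h, Finset.mul_sum, ← Finset.sum_add_distrib]
  refine Finset.sum_congr rfl fun i _ => ?_
  simp
  ring

theorem divg_const (e : E m) (y : E m) : divg (fun _ => e) y = 0 := by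
  simp [divg]

theorem sq_inner_sub_le {g e θ : E m} (he : ‖e‖ = 1) (hθ : ‖θ‖ = 1) :
    (⟪g, e⟫ - ⟪e, θ⟫ * ⟪g, θ⟫) ^ 2 ≤ (‖g‖ ^ 2 - ⟪g, θ⟫ ^ 2) * (1 - ⟪e, θ⟫ ^ 2) := by
  have h := real_inner_mul_inner_self_le (g - ⟪g, θ⟫ • θ) (e - ⟪e, θ⟫ • θ)
  have hθ2 : ⟪θ, θ⟫ = 1 := by rw [real_inner_self_eq_norm_sq, hθ, one_pow]
  have he2 : ⟪e, e⟫ = 1 := by rw [real_inner_self_eq_norm_sq, he, one_pow]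
  simp only [inner_sub_left, inner_sub_right, inner_smul_left, inner_smul_right, hθ2, he2,
    RCLike.conj_to_real, real_inner_self_eq_norm_sq g, real_inner_comm θ e, real_inner_comm θ g] at h
  rw [real_inner_comm e θ, real_inner_comm g θ] at *
  nlinarith [h]

theorem sq_inner_sphere_le_one {e θ : E m} (he : ‖e‖ = 1) (hθ : ‖θ‖ = 1) : ⟪e, θ⟫ ^ 2 ≤ 1 := by
  have h := abs_real_inner_le_norm e θ
  rw [he, hθ, mul_one] at h
  exact (sq_le_one_iff_abs_le_one _).2 h

theorem two_mul_le_of_sq_le {p x T t : ℝ} (hT : 0 ≤ T) (ht : 0 ≤ t) (h : x ^ 2 ≤ T * t) :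
    2 * p * x ≤ T + p ^ 2 * t := by
  refine le_of_abs_le (abs_le_of_sq_le_sq ?_ (by positivity))
  nlinarith [sq_nonneg (T - p ^ 2 * t), mul_le_mul_of_nonneg_left h (sq_nonneg p)]

/-- Poincaré inequality on spheres, with the constant of the first spherical harmonics, for
functions that are odd under a reflection. -/
theorem integral_sq_le_of_odd (hP : IsRotInv P) {R₀ r : ℝ} (hr : r ∈ Ioo 0 R₀) {w : E m → ℝ}
    (hm : 1 ≤ m)
    (hw : ContDiffOn ℝ 1 w (ball 0 R₀)) {e : E m} (he : ‖e‖ = 1)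
    (hodd : ∀ y, w (hypRefl e y) = -w y) :
    ((m : ℝ) - 1) * ∫ θ : sphere (0 : E m) 1, w (r • (θ : E m)) ^ 2 ∂P ≤
      r ^ 2 * ∫ θ : sphere (0 : E m) 1,
        (‖gradient w (r • (θ : E m))‖ ^ 2 - ⟪gradient w (r • (θ : E m)), (θ : E m)⟫ ^ 2) ∂P := by
  have := hP.isProb
  have hm1 : (0 : ℝ) ≤ m - 1 := by have : (1 : ℝ) ≤ m := by exact_mod_cast hm
                                   linarith
  have hrm : r ∈ Ioo (-R₀) R₀ := ⟨by linarith [hr.1, hr.2], hr.2⟩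
  obtain ⟨C, hC⟩ := (isCompact_closedBall (0 : E m) r).exists_bound_of_continuousOn
    ((continuousOn_gradient hw).mono (closedBall_subset_ball hr.2))
  have hwC : ∀ θ : sphere (0 : E m) 1, w (r • (θ : E m)) ^ 2 ≤ C ^ 2 * ⟪e, r • (θ : E m)⟫ ^ 2 := by
    intro θ
    have h := abs_le_of_odd hr hw hC he hodd (y := r • (θ : E m)) (by
      rw [mem_closedBall_zero_iff, norm_smul, norm_sphere_eq, mul_one, Real.norm_eq_abs,
        abs_of_pos hr.1])
    rw [← mul_pow, ← sq_abs (w _), ← sq_abs (C * _), abs_mul]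
    exact pow_le_pow_left₀ (abs_nonneg _)
      (h.trans (mul_le_mul_of_nonneg_right (le_abs_self C) (abs_nonneg _))) 2
  have cg : Continuous fun θ : sphere (0 : E m) 1 => gradient w (r • (θ : E m)) :=
    continuous_comp_smul_sphere (continuousOn_gradient hw) hrm
  have cw : Continuous fun θ : sphere (0 : E m) 1 => w (r • (θ : E m)) :=
    continuous_comp_smul_sphere hw.continuousOn hrm
  have cθ : Continuous fun θ : sphere (0 : E m) 1 => (θ : E m) := continuous_subtype_val
  have iT : Integrable (fun θ : sphere (0 : E m) 1 => r ^ 2 *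
      (‖gradient w (r • (θ : E m))‖ ^ 2 - ⟪gradient w (r • (θ : E m)), (θ : E m)⟫ ^ 2)) P :=
    integrable_sphere (by fun_prop)
  have iw : Integrable (fun θ : sphere (0 : E m) 1 => ((m : ℝ) - 1) * w (r • (θ : E m)) ^ 2) P :=
    integrable_sphere (continuous_const.mul (cw.pow 2))
  set err : ℝ → sphere (0 : E m) 1 → ℝ := fun h θ => ((m : ℝ) - 1) * C ^ 2 * h
    + r ^ 2 * C ^ 2 * (⟪e, r • (θ : E m)⟫ ^ 2 * h / (⟪e, r • (θ : E m)⟫ ^ 2 + h) ^ 2) with herr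
  have cerr : ∀ h, 0 < h → Continuous (err h) := by
    intro h hh
    have : ∀ θ : sphere (0 : E m) 1, (⟪e, r • (θ : E m)⟫ ^ 2 + h) ^ 2 ≠ 0 := fun θ => by positivity
    have c0 : Continuous fun θ : sphere (0 : E m) 1 => ⟪e, r • (θ : E m)⟫ := by fun_prop
    exact continuous_const.add (continuous_const.mul
      (((c0.pow 2).mul continuous_const).div (((c0.pow 2).add continuous_const).pow 2) this))
  have hlim : Tendsto (fun h => ∫ θ, err h θ ∂P) (𝓝[>] 0) (𝓝 (∫ _ : sphere (0 : E m) 1, (0 : ℝ) ∂P)) := by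
    refine tendsto_integral_filter_of_dominated_convergence
      (fun _ => ((m : ℝ) - 1) * C ^ 2 + r ^ 2 * C ^ 2) ?_ ?_ (integrable_const _) ?_
    · filter_upwards [self_mem_nhdsWithin] with h hh
      exact (cerr h hh).aestronglyMeasurable
    · filter_upwards [Ioo_mem_nhdsGT (zero_lt_one' ℝ)] with h hh
      refine Eventually.of_forall fun θ => ?_
      have hh0 := hh.1
      have h1 : ⟪e, r • (θ : E m)⟫ ^ 2 * h / (⟪e, r • (θ : E m)⟫ ^ 2 + h) ^ 2 ≤ 1 := by
        rw [div_le_one (by positivity)]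
        nlinarith [sq_nonneg (⟪e, r • (θ : E m)⟫ ^ 2), sq_nonneg h,
          mul_nonneg (sq_nonneg (⟪e, r • (θ : E m)⟫)) hh0.le]
      have h2 : 0 ≤ ⟪e, r • (θ : E m)⟫ ^ 2 * h / (⟪e, r • (θ : E m)⟫ ^ 2 + h) ^ 2 := by positivity
      have hmC : 0 ≤ ((m : ℝ) - 1) * C ^ 2 := by positivity
      have hrC : 0 ≤ r ^ 2 * C ^ 2 := by positivity
      rw [Real.norm_eq_abs, abs_of_nonneg (by positivity)]
      exact add_le_add (mul_le_of_le_one_right hmC hh.2.le) (mul_le_of_le_one_right hrC h1)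
    · refine Eventually.of_forall fun θ => ?_
      by_cases h0 : ⟪e, r • (θ : E m)⟫ = 0
      · have : (fun h => err h θ) = fun h => ((m : ℝ) - 1) * C ^ 2 * h := by
          funext h; simp [herr, h0]
        rw [this]
        exact (Continuous.tendsto' (by fun_prop) _ _ (by simp)).mono_left nhdsWithin_le_nhds
      · have hc : ContinuousAt (fun h => err h θ) 0 := by
          have : ((⟪e, r • (θ : E m)⟫ ^ 2 + 0) ^ 2 : ℝ) ≠ 0 := by rw [add_zero]; positivity
          exact (continuousAt_const.mul continuousAt_id).add (continuousAt_const.mul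
            ((continuousAt_const.mul continuousAt_id).div
              ((continuousAt_const.add continuousAt_id).pow 2) this))
        have h00 : err 0 θ = 0 := by simp [herr]
        have := hc.tendsto
        rw [h00] at this
        exact this.mono_left nhdsWithin_le_nhds
  rw [integral_zero] at hlim
  rw [← integral_const_mul, ← integral_const_mul]
  suffices hmain : ∀ h, 0 < h → ∫ θ : sphere (0 : E m) 1, ((m : ℝ) - 1) * w (r • (θ : E m)) ^ 2 ∂P
      ≤ ∫ θ : sphere (0 : E m) 1, r ^ 2 * (‖gradient w (r • (θ : E m))‖ ^ 2
        - ⟪gradient w (r • (θ : E m)), (θ : E m)⟫ ^ 2) ∂P + ∫ θ, err h θ ∂P by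
    have h2 := hlim.const_add (∫ θ : sphere (0 : E m) 1, r ^ 2 * (‖gradient w (r • (θ : E m))‖ ^ 2
        - ⟪gradient w (r • (θ : E m)), (θ : E m)⟫ ^ 2) ∂P)
    rw [add_zero] at h2
    refine ge_of_tendsto h2 ?_
    filter_upwards [self_mem_nhdsWithin] with h hh using hmain h hh
  intro h hh
  set k : ℝ → ℝ := fun t => t / (t ^ 2 + h) with hk
  set k' : ℝ → ℝ := fun t => (h - t ^ 2) / (t ^ 2 + h) ^ 2 with hk'
  have hkd : ∀ t, HasDerivAt k (k' t) t := by
    intro t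
    have hne : t ^ 2 + h ≠ 0 := by positivity
    refine ((hasDerivAt_id t).div (((hasDerivAt_pow 2 t)).add_const h) hne).congr_deriv ?_
    simp [hk']; ring
  have hkc : ContDiff ℝ 1 k := by
    refine contDiff_id.div (by fun_prop) fun t => ?_
    have : t ^ 2 + h ≠ 0 := by positivity
    exact this
  set f : E m → ℝ := fun y => w y ^ 2 * k ⟪e, y⟫ with hf
  have hfc : ContDiffOn ℝ 1 f (ball 0 R₀) :=
    (hw.pow 2).mul (hkc.comp_contDiffOn (contDiff_const.inner ℝ contDiff_id).contDiffOn)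
  have hfd : ∀ y ∈ ball (0 : E m) R₀, ∀ z, fderiv ℝ f y z =
      2 * w y * k ⟪e, y⟫ * ⟪gradient w y, z⟫ + w y ^ 2 * k' ⟪e, y⟫ * ⟪e, z⟫ := by
    intro y hy z
    have h1 := ((hw.differentiableOn one_ne_zero).differentiableAt
      (isOpen_ball.mem_nhds hy)).hasFDerivAt
    have h2 : HasFDerivAt (fun y => k ⟪e, y⟫) (k' ⟪e, y⟫ • (innerSL ℝ e)) y :=
      (hkd ⟪e, y⟫).comp_hasFDerivAt y (innerSL ℝ e).hasFDerivAt
    have h3 := ((h1.pow 2).mul h2).fderiv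
    rw [← fderiv_eq_inner_gradient]
    have h4 := congrArg (fun L => L z) h3
    refine Eq.trans h4 ?_
    simp
    ring
  have hV : ContDiffOn ℝ 1 (fun y => f y • e) (ball 0 R₀) := hfc.smul contDiffOn_const
  have key := integral_divg_sphere hP hr hV
  have hfa : ∀ θ : sphere (0 : E m) 1, DifferentiableAt ℝ f (r • (θ : E m)) := fun θ =>
    (hfc.differentiableOn one_ne_zero).differentiableAt
      (isOpen_ball.mem_nhds (smul_sphere_mem_ball hrm θ))
  have hpt : ∀ θ : sphere (0 : E m) 1,
      r * divg (fun y => f y • e) (r • (θ : E m)) - ((m : ℝ) - 1) * ⟪f (r • (θ : E m)) • e, (θ : E m)⟫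
      - r * ⟪fderiv ℝ (fun y => f y • e) (r • (θ : E m)) θ, (θ : E m)⟫ =
      r * (2 * w (r • (θ : E m)) * k (r * ⟪e, (θ : E m)⟫) *
        (⟪gradient w (r • (θ : E m)), e⟫ - ⟪e, (θ : E m)⟫ * ⟪gradient w (r • (θ : E m)), (θ : E m)⟫)
        + w (r • (θ : E m)) ^ 2 * k' (r * ⟪e, (θ : E m)⟫) * (1 - ⟪e, (θ : E m)⟫ ^ 2))
        - ((m : ℝ) - 1) * (w (r • (θ : E m)) ^ 2 * k (r * ⟪e, (θ : E m)⟫) * ⟪e, (θ : E m)⟫) := by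
    intro θ
    rw [divg_smul (hfa θ) (differentiableAt_const _), divg_const,
      ((hfa θ).hasFDerivAt.smul_const e).fderiv, ← fderiv_eq_inner_gradient,
      ContinuousLinearMap.smulRight_apply, inner_smul_left, inner_smul_left,
      hfd _ (smul_sphere_mem_ball hrm θ), hfd _ (smul_sphere_mem_ball hrm θ),
      real_inner_self_eq_norm_sq, he, inner_smul_right]
    simp only [hf, RCLike.conj_to_real, inner_smul_right]
    ring
  have cX : Continuous fun θ : sphere (0 : E m) 1 => r * divg (fun y => f y • e) (r • (θ : E m))
      - ((m : ℝ) - 1) * ⟪f (r • (θ : E m)) • e, (θ : E m)⟫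
      - r * ⟪fderiv ℝ (fun y => f y • e) (r • (θ : E m)) θ, (θ : E m)⟫ := by
    have c1 : Continuous fun θ : sphere (0 : E m) 1 => divg (fun y => f y • e) (r • (θ : E m)) :=
      continuous_comp_smul_sphere (continuousOn_divg hV) hrm
    have c2 : Continuous fun θ : sphere (0 : E m) 1 => ⟪f (r • (θ : E m)) • e, (θ : E m)⟫ :=
      (continuous_comp_smul_sphere hV.continuousOn hrm).inner cθ
    have c3 : Continuous fun θ : sphere (0 : E m) 1 =>
        ⟪fderiv ℝ (fun y => f y • e) (r • (θ : E m)) θ, (θ : E m)⟫ :=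
      ((continuous_comp_smul_sphere (hV.continuousOn_fderiv_of_isOpen isOpen_ball le_rfl)
        hrm).clm_apply cθ).inner cθ
    exact ((continuous_const.mul c1).sub (continuous_const.mul c2)).sub (continuous_const.mul c3)
  have iX := (integrable_sphere (P := P) cX).const_mul r
  have ie := integrable_sphere (P := P) (cerr h hh)
  have hsum := integral_mono (iw.add iX) (iT.add ie) (fun θ => ?_)
  · rw [integral_add' iw iX, integral_add' iT ie, integral_const_mul r, key, mul_zero,
      add_zero] at hsum
    exact hsum
  · simp only [Pi.add_apply]
    rw [hpt]
    have hθ := norm_sphere_eq θ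
    have hsq := hwC θ
    simp only [herr]
    rw [inner_smul_right] at hsq ⊢
    have hcs := sq_inner_sub_le (g := gradient w (r • (θ : E m))) he hθ
    have ht1 := sq_inner_sphere_le_one he hθ
    have hT0 : 0 ≤ ‖gradient w (r • (θ : E m))‖ ^ 2 - ⟪gradient w (r • (θ : E m)), (θ : E m)⟫ ^ 2 := by
      have := abs_real_inner_le_norm (gradient w (r • (θ : E m))) (θ : E m)
      rw [hθ, mul_one] at this
      have := pow_le_pow_left₀ (abs_nonneg _) this 2
      rw [sq_abs] at this
      linarith
    generalize ⟪gradient w (r • (θ : E m)), e⟫ - ⟪e, (θ : E m)⟫ *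
      ⟪gradient w (r • (θ : E m)), (θ : E m)⟫ = x at *
    generalize ‖gradient w (r • (θ : E m))‖ ^ 2 - ⟪gradient w (r • (θ : E m)), (θ : E m)⟫ ^ 2 = T at *
    generalize ⟪e, (θ : E m)⟫ = c at *
    generalize w (r • (θ : E m)) = W at *
    have hyo := two_mul_le_of_sq_le (p := W * k (r * c)) hT0 (sub_nonneg.2 ht1) hcs
    have hD : 0 < (r * c) ^ 2 + h := by positivity
    have hkk : k (r * c) ^ 2 + k' (r * c) = h / ((r * c) ^ 2 + h) ^ 2 := by
      simp only [hk, hk']; field_simp; ring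
    have hrk : r * (k (r * c) * c) = 1 - h / ((r * c) ^ 2 + h) := by
      simp only [hk]; field_simp; ring
    have hq : 0 ≤ h / ((r * c) ^ 2 + h) ^ 2 := by positivity
    have e1 : W ^ 2 * (h / ((r * c) ^ 2 + h)) ≤ C ^ 2 * h := by
      rw [← mul_div_assoc, div_le_iff₀ hD]
      nlinarith [mul_le_mul_of_nonneg_right hsq hh.le, mul_nonneg (sq_nonneg C) (mul_nonneg hh.le hh.le)]
    have e2 : W ^ 2 * (h / ((r * c) ^ 2 + h) ^ 2) * (1 - c ^ 2) ≤
        C ^ 2 * ((r * c) ^ 2 * h / ((r * c) ^ 2 + h) ^ 2) := by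
      have := mul_le_mul_of_nonneg_right hsq hq
      calc _ ≤ W ^ 2 * (h / ((r * c) ^ 2 + h) ^ 2) * 1 :=
            mul_le_mul_of_nonneg_left (by linarith [sq_nonneg c]) (by positivity)
        _ ≤ _ := by rw [mul_one, mul_div_assoc]; linarith
    have e3 := mul_le_mul_of_nonneg_left e1 hm1
    have e4 := mul_le_mul_of_nonneg_left e2 (sq_nonneg r)
    have e5 := mul_le_mul_of_nonneg_left hyo (sq_nonneg r)
    calc _ = ((m : ℝ) - 1) * W ^ 2 + r ^ 2 * (2 * (W * k (r * c)) * x)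
          + r ^ 2 * (W ^ 2 * k' (r * c) * (1 - c ^ 2))
          - ((m : ℝ) - 1) * (W ^ 2 * (r * (k (r * c) * c))) := by ring
      _ = r ^ 2 * (2 * (W * k (r * c)) * x) + r ^ 2 * (W ^ 2 * k' (r * c) * (1 - c ^ 2))
          + ((m : ℝ) - 1) * (W ^ 2 * (h / ((r * c) ^ 2 + h))) := by rw [hrk]; ring
      _ ≤ r ^ 2 * (T + (W * k (r * c)) ^ 2 * (1 - c ^ 2))
          + r ^ 2 * (W ^ 2 * k' (r * c) * (1 - c ^ 2)) + ((m : ℝ) - 1) * (C ^ 2 * h) := by linarith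
      _ = r ^ 2 * T + r ^ 2 * (W ^ 2 * (k (r * c) ^ 2 + k' (r * c)) * (1 - c ^ 2))
          + ((m : ℝ) - 1) * (C ^ 2 * h) := by ring
      _ ≤ _ := by rw [hkk]; linarith

/-- The part of a function that is odd under the reflection `hypRefl e`. -/
noncomputable def oddPart (e : E m) (v : E m → ℝ) (y : E m) : ℝ := (v y - v (hypRefl e y)) / 2

theorem oddPart_hypRefl (e : E m) (v : E m → ℝ) (y : E m) :
    oddPart e v (hypRefl e y) = -oddPart e v y := by
  rw [oddPart, oddPart, hypRefl_hypRefl]; ring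

theorem hypRefl_mem_ball {R₀ : ℝ} {e y : E m} (hy : y ∈ ball (0 : E m) R₀) :
    hypRefl e y ∈ ball (0 : E m) R₀ := by
  rw [mem_ball_zero_iff, LinearIsometryEquiv.norm_map]
  exact mem_ball_zero_iff.1 hy

theorem contDiffOn_oddPart {R₀ : ℝ} {v : E m → ℝ} (hv : ContDiffOn ℝ 1 v (ball 0 R₀)) (e : E m) :
    ContDiffOn ℝ 1 (oddPart e v) (ball 0 R₀) :=
  (hv.sub (hv.comp (hypRefl e).contDiff.contDiffOn fun _ hy => hypRefl_mem_ball hy)).div_const 2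

theorem inner_hypRefl_left (e x y : E m) : ⟪hypRefl e x, y⟫ = ⟪x, hypRefl e y⟫ := by
  rw [← (hypRefl e).inner_map_map, hypRefl_hypRefl]

theorem gradient_oddPart {R₀ : ℝ} {v : E m → ℝ} (hv : ContDiffOn ℝ 1 v (ball 0 R₀)) (e : E m)
    {y : E m} (hy : y ∈ ball 0 R₀) :
    gradient (oddPart e v) y = (1 / 2 : ℝ) • (gradient v y - hypRefl e (gradient v (hypRefl e y))) := by
  have hd : ∀ z ∈ ball (0 : E m) R₀, HasFDerivAt v (fderiv ℝ v z) z := fun z hz =>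
    ((hv.differentiableOn one_ne_zero).differentiableAt (isOpen_ball.mem_nhds hz)).hasFDerivAt
  have h1 := hd y hy
  have h2 : HasFDerivAt (fun y => v (hypRefl e y))
      ((fderiv ℝ v (hypRefl e y)).comp (hypRefl e).toContinuousLinearEquiv.toContinuousLinearMap) y :=
    (hd _ (hypRefl_mem_ball hy)).comp y (hypRefl e).toContinuousLinearEquiv.hasFDerivAt
  have h3 := ((h1.sub h2).mul_const (1 / 2 : ℝ)).fderiv
  have h4 : oddPart e v = fun y => (v y - v (hypRefl e y)) * (1 / 2) := by
    funext y; rw [oddPart]; ring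
  refine ext_inner_right ℝ fun z => ?_
  rw [← fderiv_eq_inner_gradient, h4]
  refine (congrArg (fun L => L z) h3).trans ?_
  rw [inner_smul_left, inner_sub_left, inner_hypRefl_left, ← fderiv_eq_inner_gradient,
    ← fderiv_eq_inner_gradient]
  simp

theorem gradient_oddPart_hypRefl {R₀ : ℝ} {v : E m → ℝ} (hv : ContDiffOn ℝ 1 v (ball 0 R₀))
    (e : E m) {y : E m} (hy : y ∈ ball 0 R₀) :
    gradient (oddPart e v) (hypRefl e y) = -hypRefl e (gradient (oddPart e v) y) := by
  rw [gradient_oddPart hv e hy, gradient_oddPart hv e (hypRefl_mem_ball hy), hypRefl_hypRefl,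
    map_smul, map_sub, hypRefl_hypRefl]
  module

theorem integral_comp_hypRefl (hP : IsRotInv P) (e : E m) (r : ℝ) (f : E m → ℝ) :
    ∫ θ : sphere (0 : E m) 1, f (hypRefl e (r • (θ : E m))) ∂P
      = ∫ θ : sphere (0 : E m) 1, f (r • (θ : E m)) ∂P := by
  simpa using hP.integral_comp (hypRefl e) (fun y => f (r • y))

/-- Symmetrization under a reflection preserves spherical means. -/
theorem integral_eq_half_sub (hP : IsRotInv P) {R₀ r : ℝ} (hr : r ∈ Ioo 0 R₀) {e : E m}
    {f g : E m → ℝ} (hf : ContinuousOn f (ball 0 R₀))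
    (hg : ∀ y ∈ ball (0 : E m) R₀, g y = (f y + f (hypRefl e y)) / 2) :
    ∫ θ : sphere (0 : E m) 1, f (r • (θ : E m)) ∂P = ∫ θ : sphere (0 : E m) 1, g (r • (θ : E m)) ∂P := by
  have := hP.isProb
  have hrm : r ∈ Ioo (-R₀) R₀ := ⟨by linarith [hr.1, hr.2], hr.2⟩
  have i1 : Integrable (fun θ : sphere (0 : E m) 1 => f (r • (θ : E m))) P :=
    integrable_sphere (continuous_comp_smul_sphere hf hrm)
  have i2 : Integrable (fun θ : sphere (0 : E m) 1 => f (hypRefl e (r • (θ : E m)))) P :=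
    integrable_sphere (continuous_comp_smul_sphere (f := fun y => f (hypRefl e y))
      (hf.comp (hypRefl e).continuous.continuousOn fun _ hy => hypRefl_mem_ball hy) hrm)
  have hc : (fun θ : sphere (0 : E m) 1 => g (r • (θ : E m))) =
      fun θ : sphere (0 : E m) 1 => (f (r • (θ : E m)) + f (hypRefl e (r • (θ : E m)))) / 2 :=
    funext fun θ => hg _ (smul_sphere_mem_ball hrm θ)
  rw [hc, integral_div,
    integral_add i1 i2, integral_comp_hypRefl hP]
  ring

theorem integral_oddPart_mul (hP : IsRotInv P) {R₀ r : ℝ} (hr : r ∈ Ioo 0 R₀) (e : E m)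
    {v : E m → ℝ} (hv : ContDiffOn ℝ 1 v (ball 0 R₀)) :
    ∫ θ : sphere (0 : E m) 1, oddPart e v (r • (θ : E m)) * v (r • (θ : E m)) ∂P
      = ∫ θ : sphere (0 : E m) 1, oddPart e v (r • (θ : E m)) ^ 2 ∂P := by
  refine integral_eq_half_sub hP hr (e := e) (f := fun y => oddPart e v y * v y)
    (g := fun y => oddPart e v y ^ 2)
    ((contDiffOn_oddPart hv e).continuousOn.mul hv.continuousOn) fun y _ => ?_
  simp only [oddPart_hypRefl]
  simp only [oddPart]
  ring

theorem integral_inner_gradient_oddPart (hP : IsRotInv P) {R₀ r : ℝ} (hr : r ∈ Ioo 0 R₀) (e : E m)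
    {v : E m → ℝ} (hv : ContDiffOn ℝ 1 v (ball 0 R₀)) :
    ∫ θ : sphere (0 : E m) 1, ⟪gradient (oddPart e v) (r • (θ : E m)), gradient v (r • (θ : E m))⟫ ∂P
      = ∫ θ : sphere (0 : E m) 1, ‖gradient (oddPart e v) (r • (θ : E m))‖ ^ 2 ∂P := by
  refine integral_eq_half_sub hP hr (e := e)
    (f := fun y => ⟪gradient (oddPart e v) y, gradient v y⟫)
    (g := fun y => ‖gradient (oddPart e v) y‖ ^ 2)
    ((continuousOn_gradient (contDiffOn_oddPart hv e)).inner (continuousOn_gradient hv)) fun y hy => ?_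
  simp only [gradient_oddPart_hypRefl hv e hy, inner_neg_left, inner_hypRefl_left]
  rw [← real_inner_self_eq_norm_sq, ← sub_eq_add_neg, ← inner_sub_right]
  nth_rewrite 2 [gradient_oddPart hv e hy]
  rw [inner_smul_right]
  ring

theorem integral_oddPart_mul_inner (hP : IsRotInv P) {R₀ r : ℝ} (hr : r ∈ Ioo 0 R₀) (e : E m)
    {v : E m → ℝ} (hv : ContDiffOn ℝ 1 v (ball 0 R₀)) :
    ∫ θ : sphere (0 : E m) 1, oddPart e v (r • (θ : E m)) *
        ⟪gradient v (r • (θ : E m)), (θ : E m)⟫ ∂P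
      = ∫ θ : sphere (0 : E m) 1, oddPart e v (r • (θ : E m)) *
        ⟪gradient (oddPart e v) (r • (θ : E m)), (θ : E m)⟫ ∂P := by
  have key := integral_eq_half_sub hP hr (e := e)
    (f := fun y => oddPart e v y * ⟪gradient v y, r⁻¹ • y⟫)
    (g := fun y => oddPart e v y * ⟪gradient (oddPart e v) y, r⁻¹ • y⟫)
    ((contDiffOn_oddPart hv e).continuousOn.mul ((continuousOn_gradient hv).inner
      (by fun_prop))) fun y hy => by
    simp only [oddPart_hypRefl, gradient_oddPart hv e hy, ← map_smul]
    rw [inner_smul_left, inner_sub_left, inner_hypRefl_left]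
    simp
    ring
  simpa [smul_smul, inv_mul_cancel₀ hr.1.ne'] using key

theorem sq_integral_le {X : Type*} [MeasurableSpace X] {μ : Measure X} [IsProbabilityMeasure μ]
    {f : X → ℝ} (i1 : Integrable f μ) (i2 : Integrable (fun x => f x ^ 2) μ) :
    (∫ x, f x ∂μ) ^ 2 ≤ ∫ x, f x ^ 2 ∂μ := by
  set c := ∫ x, f x ∂μ with hc
  have i3 : Integrable (fun x => 2 * c * f x) μ := i1.const_mul (2 * c)
  have i4 : Integrable (fun x => f x ^ 2 - 2 * c * f x) μ := i2.sub i3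
  have h : 0 ≤ ∫ x, (f x ^ 2 - 2 * c * f x + c ^ 2) ∂μ :=
    integral_nonneg fun x => by
      have := sq_nonneg (f x - c)
      simp only [Pi.zero_apply]
      linarith
  rw [integral_add i4 (integrable_const _), integral_sub i2 i3, integral_const_mul, ← hc] at h
  simp at h
  linarith

theorem integral_abs_le_sqrt [IsProbabilityMeasure P] {f : sphere (0 : E m) 1 → ℝ}
    (hf : Continuous f) : ∫ θ, |f θ| ∂P ≤ √(∫ θ, f θ ^ 2 ∂P) := by
  refine Real.le_sqrt_of_sq_le ?_
  simpa using sq_integral_le (integrable_sphere (P := P) hf.abs)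
    (integrable_sphere (P := P) (hf.abs.pow 2))

theorem norm_smul_sphere {r : ℝ} (hr : 0 < r) (θ : sphere (0 : E m) 1) : ‖r • (θ : E m)‖ = r := by
  rw [norm_smul, norm_sphere_eq, mul_one, Real.norm_eq_abs, abs_of_pos hr]

theorem energy_lower_bound {g F θ : E m} {A f w ψ δ μ r G : ℝ} (hθ : ‖θ‖ = 1) (hA : 0 < A)
    (hr : 0 < r) (hf : 0 ≤ f) (hF : ‖F‖ ≤ A * f) (hG : |G| ≤ A * (f / r)) (hδ : 0 < δ)
    (hμ : 0 < μ) :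
    A * (2 * ψ * (w * ⟪g, θ⟫) - ψ ^ 2 * w ^ 2 + (1 - δ) * (‖g‖ ^ 2 - ⟪g, θ⟫ ^ 2) - μ * w ^ 2
      - f ^ 2 * (1 / 4 + 1 / (4 * δ) + ψ ^ 2 / (2 * μ) + 1 / (2 * μ * r ^ 2)))
      ≤ A * ‖g‖ ^ 2 - ⟪g, F⟫ + w * G := by
  set a := ⟪g, θ⟫ with ha
  set T := ‖g - a • θ‖ with hT
  have hT2 : T ^ 2 = ‖g‖ ^ 2 - a ^ 2 := by
    rw [hT, norm_sub_sq_real, inner_smul_right, ← ha, norm_smul, hθ, mul_one, Real.norm_eq_abs,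
      sq_abs]
    ring
  have hT0 : 0 ≤ T := norm_nonneg _
  have h1 : ⟪g, F⟫ ≤ (|a| + T) * (A * f) := by
    have : g = a • θ + (g - a • θ) := by abel
    calc ⟪g, F⟫ ≤ ‖g‖ * ‖F‖ := real_inner_le_norm _ _
      _ ≤ (|a| + T) * (A * f) := by
        refine mul_le_mul ?_ hF (norm_nonneg _) (by positivity)
        rw [this]
        refine (norm_add_le _ _).trans (le_of_eq ?_)
        rw [norm_smul, hθ, mul_one, Real.norm_eq_abs]
  have h2 : |a| ≤ |a - ψ * w| + |ψ| * |w| := by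
    rw [← abs_mul]
    calc |a| = |a - ψ * w + ψ * w| := by ring_nf
      _ ≤ _ := abs_add_le _ _
  have h3 : -(|w| * (A * (f / r))) ≤ w * G := by
    have := mul_le_mul_of_nonneg_left hG (abs_nonneg w)
    rw [← abs_mul] at this
    linarith [neg_abs_le (w * G)]
  have y1 : |a - ψ * w| * f ≤ (a - ψ * w) ^ 2 + f ^ 2 / 4 := by
    nlinarith [sq_nonneg (|a - ψ * w| - f / 2), sq_abs (a - ψ * w)]
  have y2 : T * f ≤ δ * T ^ 2 + f ^ 2 * (1 / (4 * δ)) := by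
    have : δ * T ^ 2 + f ^ 2 * (1 / (4 * δ)) - T * f = (2 * δ * T - f) ^ 2 / (4 * δ) := by
      field_simp; ring
    have : 0 ≤ (2 * δ * T - f) ^ 2 / (4 * δ) := by positivity
    linarith
  have y3 : |ψ| * |w| * f ≤ μ / 2 * w ^ 2 + f ^ 2 * (ψ ^ 2 / (2 * μ)) := by
    have : μ / 2 * w ^ 2 + f ^ 2 * (ψ ^ 2 / (2 * μ)) - |ψ| * |w| * f
        = (μ * |w| - f * |ψ|) ^ 2 / (2 * μ) := by
      rw [← sq_abs w, ← sq_abs ψ]; field_simp; ring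
    have : 0 ≤ (μ * |w| - f * |ψ|) ^ 2 / (2 * μ) := by positivity
    linarith
  have y4 : |w| * (f / r) ≤ μ / 2 * w ^ 2 + f ^ 2 * (1 / (2 * μ * r ^ 2)) := by
    have : μ / 2 * w ^ 2 + f ^ 2 * (1 / (2 * μ * r ^ 2)) - |w| * (f / r)
        = (μ * |w| - f / r) ^ 2 / (2 * μ) := by
      rw [← sq_abs w]; field_simp; ring
    have : 0 ≤ (μ * |w| - f / r) ^ 2 / (2 * μ) := by positivity
    linarith
  have hAf : 0 ≤ A * f := by positivity
  have h4 := mul_le_mul_of_nonneg_right h2 hAf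
  have y5 := mul_le_mul_of_nonneg_left (add_le_add (add_le_add y1 y2) (add_le_add y3 y4)) hA.le
  rw [← hT2]
  have hg : ‖g‖ ^ 2 = T ^ 2 + a ^ 2 := by linarith
  rw [hg]
  linarith

theorem integral_linear_combination {X : Type*} [MeasurableSpace X] {μ : Measure X}
    [IsProbabilityMeasure μ] {f g h : X → ℝ} (hf : Integrable f μ) (hg : Integrable g μ)
    (hh : Integrable h μ) (a b c d k : ℝ) :
    ∫ x, (a * f x - b * g x + c * h x - d * g x - k) ∂μ
      = a * ∫ x, f x ∂μ - b * ∫ x, g x ∂μ + c * ∫ x, h x ∂μ - d * ∫ x, g x ∂μ - k := by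
  have i1 : Integrable (fun x => a * f x - b * g x) μ := (hf.const_mul a).sub (hg.const_mul b)
  have i2 : Integrable (fun x => a * f x - b * g x + c * h x) μ := i1.add (hh.const_mul c)
  have i3 : Integrable (fun x => a * f x - b * g x + c * h x - d * g x) μ :=
    i2.sub (hg.const_mul d)
  rw [integral_sub i3 (integrable_const k), integral_sub i2 (hg.const_mul d),
    integral_add i1 (hh.const_mul c), integral_sub (hf.const_mul a) (hg.const_mul b)]
  simp only [integral_const_mul, integral_const, probReal_univ, one_smul]

/-- Decay of the part of a solution that is odd under a reflection. -/
theorem integral_sq_oddPart_le (hm : 1 ≤ m) {γ κ R₀ c Cφ Cκ CΘ : ℝ} (hc : 0 < c) (hCφ : 0 < Cφ)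
    (hCκ : 0 < Cκ) :
    ∃ C > 0, ∀ φ φ' φ'' Θ θ, IsBarrier m γ κ R₀ c Cφ Cκ CΘ φ φ' φ'' Θ θ →
      ∀ P : Measure (sphere (0 : E m) 1), IsRotInv P →
      ∀ ε ρ N : ℝ, ∀ (v G : E m → ℝ) (F : E m → E m), 0 < ε → 0 ≤ N → 0 < ρ → ρ < R₀ →
        ContDiffOn ℝ 2 v (ball 0 R₀) → ContDiffOn ℝ 1 F (ball 0 R₀) → ContinuousOn G (ball 0 R₀) →
        (∀ y ∈ ball (0 : E m) R₀,
          divg (fun y => (ε + ‖y‖ ^ 2) • gradient v y - F y) y = 2 / γ * v y + G y) →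
        (∀ y ∈ ball (0 : E m) R₀, y ≠ 0 → ‖F y‖ ≤ (ε + ‖y‖ ^ 2) * (N * ‖y‖ ^ (κ - 1))) →
        (∀ y ∈ ball (0 : E m) R₀, y ≠ 0 → |G y| ≤ (ε + ‖y‖ ^ 2) * (N * ‖y‖ ^ (κ - 1) / ‖y‖)) →
        ∀ e : E m, ‖e‖ = 1 → ∀ r ∈ Ioc 0 ρ,
          ∫ θ : sphere (0 : E m) 1, oddPart e v (r • (θ : E m)) ^ 2 ∂P ≤ C * φ r ^ 2 *
            ((∫ θ : sphere (0 : E m) 1, oddPart e v (ρ • (θ : E m)) ^ 2 ∂P) / φ ρ ^ 2 + N ^ 2) := by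
  obtain ⟨C, hC, hmain⟩ := le_of_isBarrier (m := m) (γ := γ) (κ := κ) (R₀ := R₀) (c := c) (Cφ := Cφ)
    (Cκ := Cκ) (CΘ := CΘ) (by exact_mod_cast hm) hc hCφ hCκ
  refine ⟨C, hC, fun φ φ' φ'' Θ θ hB P hP ε ρ N v G F hε hN hρ hρR hv hF hG hdiv hFb hGb e he => ?_⟩
  have := hP.isProb
  have hv1 : ContDiffOn ℝ 1 v (ball 0 R₀) := hv.of_le (by norm_num)
  set U : E m → E m := fun y => (ε + ‖y‖ ^ 2) • gradient v y - F y with hU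
  have hgv : ContDiffOn ℝ 1 (gradient v) (ball 0 R₀) :=
    (InnerProductSpace.toDual ℝ (E m)).symm.contDiff.comp_contDiffOn
      (hv.fderiv_of_isOpen isOpen_ball (by norm_num))
  have hA1 : ContDiff ℝ 1 fun y : E m => ε + ‖y‖ ^ 2 := contDiff_const.add (contDiff_norm_sq ℝ)
  have hUc : ContDiffOn ℝ 1 U (ball 0 R₀) := (hA1.contDiffOn.smul hgv).sub hF
  set w := oddPart e v with hw
  have hwc : ContDiffOn ℝ 1 w (ball 0 R₀) := contDiffOn_oddPart hv1 e
  have hwU : ContDiffOn ℝ 1 (fun y => w y • U y) (ball 0 R₀) := hwc.smul hUc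
  have hmem : ∀ r ∈ Ioc 0 ρ, r ∈ Ioo 0 R₀ := fun r hr => ⟨hr.1, hr.2.trans_lt hρR⟩
  have hmem' : ∀ r ∈ Ioc 0 ρ, r ∈ Ioo (-R₀) R₀ := fun r hr => ⟨by linarith [hr.1], (hmem r hr).2⟩
  have cw : ∀ r ∈ Ioc 0 ρ, Continuous fun θ : sphere (0 : E m) 1 => w (r • (θ : E m)) := fun r hr =>
    continuous_comp_smul_sphere hwc.continuousOn (hmem' r hr)
  have cgw : ∀ r ∈ Ioc 0 ρ, Continuous fun θ : sphere (0 : E m) 1 => gradient w (r • (θ : E m)) :=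
    fun r hr => continuous_comp_smul_sphere (continuousOn_gradient hwc) (hmem' r hr)
  have cgv : ∀ r ∈ Ioc 0 ρ, Continuous fun θ : sphere (0 : E m) 1 => gradient v (r • (θ : E m)) :=
    fun r hr => continuous_comp_smul_sphere (continuousOn_gradient hv1) (hmem' r hr)
  have cv : ∀ r ∈ Ioc 0 ρ, Continuous fun θ : sphere (0 : E m) 1 => v (r • (θ : E m)) := fun r hr =>
    continuous_comp_smul_sphere hv.continuousOn (hmem' r hr)
  have cF : ∀ r ∈ Ioc 0 ρ, Continuous fun θ : sphere (0 : E m) 1 => F (r • (θ : E m)) := fun r hr =>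
    continuous_comp_smul_sphere hF.continuousOn (hmem' r hr)
  have cG : ∀ r ∈ Ioc 0 ρ, Continuous fun θ : sphere (0 : E m) 1 => G (r • (θ : E m)) := fun r hr =>
    continuous_comp_smul_sphere hG (hmem' r hr)
  have cU : ∀ r ∈ Ioc 0 ρ, Continuous fun θ : sphere (0 : E m) 1 => U (r • (θ : E m)) := fun r hr =>
    continuous_comp_smul_sphere hUc.continuousOn (hmem' r hr)
  have cθ : Continuous fun θ : sphere (0 : E m) 1 => (θ : E m) := continuous_subtype_val
  obtain ⟨K, hK⟩ := (isCompact_closedBall (0 : E m) ρ).exists_bound_of_continuousOn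
    ((continuousOn_gradient hwc).mono (closedBall_subset_ball hρR))
  obtain ⟨L, hL⟩ := (isCompact_closedBall (0 : E m) ρ).exists_bound_of_continuousOn
    (hUc.continuousOn.mono (closedBall_subset_ball hρR))
  have hmc : ∀ r ∈ Ioc 0 ρ, ∀ θ : sphere (0 : E m) 1, r • (θ : E m) ∈ closedBall (0 : E m) ρ := by
    intro r hr θ
    rw [mem_closedBall_zero_iff, norm_smul_sphere hr.1]
    exact hr.2
  have hwK : ∀ r ∈ Ioc 0 ρ, ∀ θ : sphere (0 : E m) 1, |w (r • (θ : E m))| ≤ |K| * r := by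
    intro r hr θ
    refine (abs_le_of_odd ⟨hρ, hρR⟩ hwc hK he (oddPart_hypRefl e v) (hmc r hr θ)).trans ?_
    refine mul_le_mul (le_abs_self K) ?_ (abs_nonneg _) (abs_nonneg _)
    have := abs_real_inner_le_norm e (r • (θ : E m))
    rwa [he, one_mul, norm_smul_sphere hr.1] at this
  refine hmain φ φ' φ'' Θ θ hB ε ρ N (K ^ 2 + |K| * |L|)
    (fun r => ∫ θ : sphere (0 : E m) 1, w (r • (θ : E m)) ^ 2 ∂P)
    (fun r => 2 * ∫ θ : sphere (0 : E m) 1, w (r • (θ : E m)) *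
      ⟪gradient w (r • (θ : E m)), (θ : E m)⟫ ∂P)
    (fun r => ∫ θ : sphere (0 : E m) 1, w (r • (θ : E m)) * ⟪U (r • (θ : E m)), (θ : E m)⟫ ∂P)
    (fun r => ∫ θ : sphere (0 : E m) 1, w (r • (θ : E m)) * ⟪F (r • (θ : E m)), (θ : E m)⟫ ∂P)
    (fun r => ∫ θ : sphere (0 : E m) 1, ((ε + r ^ 2) * ‖gradient w (r • (θ : E m))‖ ^ 2
      - ⟪gradient w (r • (θ : E m)), F (r • (θ : E m))⟫ + w (r • (θ : E m)) * G (r • (θ : E m))) ∂P)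
    hε hN hρR.le ?_ ?_ ?_ ?_ ?_ ?_ ?_ ?_
  · exact fun r _ => integral_nonneg fun θ => sq_nonneg _
  · intro r hr
    refine (hasDerivAt_integral_radial hP (hmem r hr) (hwc.pow 2)).congr_deriv ?_
    rw [← integral_const_mul]
    refine integral_congr_ae (Eventually.of_forall fun θ => ?_)
    have h1 := (((hwc.differentiableOn one_ne_zero).differentiableAt
      (isOpen_ball.mem_nhds (smul_sphere_mem_ball (hmem' r hr) θ))).hasFDerivAt.pow 2).fderiv
    simp only
    rw [← fderiv_eq_inner_gradient, ← fderiv_eq_inner_gradient]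
    refine (congrArg (fun L => L (θ : E m)) h1).trans ?_
    simp
    ring
  · intro r hr
    have h := hasDerivAt_integral_flux hP (hmem r hr) hwU
    simp only [inner_smul_left, RCLike.conj_to_real] at h
    refine h.congr_deriv ?_
    congr 1
    rw [hw, ← integral_oddPart_mul hP (hmem r hr) e hv1, ← hw]
    have hpt : (fun θ : sphere (0 : E m) 1 => divg (fun y => w y • U y) (r • (θ : E m))) =
        fun θ : sphere (0 : E m) 1 =>
          (ε + r ^ 2) * ⟪gradient w (r • (θ : E m)), gradient v (r • (θ : E m))⟫
          + (w (r • (θ : E m)) * G (r • (θ : E m))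
            - ⟪gradient w (r • (θ : E m)), F (r • (θ : E m))⟫)
          + 2 / γ * (w (r • (θ : E m)) * v (r • (θ : E m))) := by
      funext θ
      have hy := smul_sphere_mem_ball (hmem' r hr) θ
      rw [divg_smul ((hwc.differentiableOn one_ne_zero).differentiableAt (isOpen_ball.mem_nhds hy))
        ((hUc.differentiableOn one_ne_zero).differentiableAt (isOpen_ball.mem_nhds hy)), hdiv _ hy]
      simp only [hU, inner_sub_right, inner_smul_right, norm_smul_sphere hr.1]
      ring
    have hpt2 : (fun θ : sphere (0 : E m) 1 => (ε + r ^ 2) * ‖gradient w (r • (θ : E m))‖ ^ 2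
        - ⟪gradient w (r • (θ : E m)), F (r • (θ : E m))⟫ + w (r • (θ : E m)) * G (r • (θ : E m))) =
        fun θ : sphere (0 : E m) 1 => (ε + r ^ 2) * ‖gradient w (r • (θ : E m))‖ ^ 2
          + (w (r • (θ : E m)) * G (r • (θ : E m))
            - ⟪gradient w (r • (θ : E m)), F (r • (θ : E m))⟫) := by
      funext θ; ring
    have i1 : Integrable (fun θ : sphere (0 : E m) 1 =>
        (ε + r ^ 2) * ⟪gradient w (r • (θ : E m)), gradient v (r • (θ : E m))⟫) P :=
      integrable_sphere (continuous_const.mul ((cgw r hr).inner (cgv r hr)))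
    have i2 : Integrable (fun θ : sphere (0 : E m) 1 => w (r • (θ : E m)) * G (r • (θ : E m))
            - ⟪gradient w (r • (θ : E m)), F (r • (θ : E m))⟫) P :=
      integrable_sphere (((cw r hr).mul (cG r hr)).sub ((cgw r hr).inner (cF r hr)))
    have i3 : Integrable (fun θ : sphere (0 : E m) 1 =>
        2 / γ * (w (r • (θ : E m)) * v (r • (θ : E m)))) P :=
      integrable_sphere (continuous_const.mul ((cw r hr).mul (cv r hr)))
    have i4 : Integrable (fun θ : sphere (0 : E m) 1 =>
        (ε + r ^ 2) * ‖gradient w (r • (θ : E m))‖ ^ 2) P :=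
      integrable_sphere (continuous_const.mul ((cgw r hr).norm.pow 2))
    have i12 : Integrable (fun θ : sphere (0 : E m) 1 =>
        (ε + r ^ 2) * ⟪gradient w (r • (θ : E m)), gradient v (r • (θ : E m))⟫
        + (w (r • (θ : E m)) * G (r • (θ : E m))
            - ⟪gradient w (r • (θ : E m)), F (r • (θ : E m))⟫)) P := i1.add i2
    rw [hpt, hpt2, integral_add i12 i3, integral_add i1 i2, integral_add i4 i2,
      integral_const_mul, integral_const_mul, integral_const_mul,
      integral_inner_gradient_oddPart hP (hmem r hr) e hv1]
  · intro r hr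
    have hpt : (fun θ : sphere (0 : E m) 1 => w (r • (θ : E m)) * ⟪U (r • (θ : E m)), (θ : E m)⟫) =
        fun θ : sphere (0 : E m) 1 =>
          (ε + r ^ 2) * (w (r • (θ : E m)) * ⟪gradient v (r • (θ : E m)), (θ : E m)⟫)
          - w (r • (θ : E m)) * ⟪F (r • (θ : E m)), (θ : E m)⟫ := by
      funext θ
      simp only [hU, inner_sub_left, inner_smul_left, norm_smul_sphere hr.1, RCLike.conj_to_real]
      ring
    have i1 : Integrable (fun θ : sphere (0 : E m) 1 =>
        (ε + r ^ 2) * (w (r • (θ : E m)) * ⟪gradient v (r • (θ : E m)), (θ : E m)⟫)) P :=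
      integrable_sphere (continuous_const.mul ((cw r hr).mul ((cgv r hr).inner cθ)))
    have i2 : Integrable (fun θ : sphere (0 : E m) 1 =>
        w (r • (θ : E m)) * ⟪F (r • (θ : E m)), (θ : E m)⟫) P :=
      integrable_sphere ((cw r hr).mul ((cF r hr).inner cθ))
    rw [hpt, integral_sub i1 i2, integral_const_mul,
      integral_oddPart_mul_inner hP (hmem r hr) e hv1]
    ring
  · intro r hr
    have hN' : 0 ≤ N * r ^ (κ - 1) := mul_nonneg hN (Real.rpow_nonneg hr.1.le _)
    have hFr : ∀ θ : sphere (0 : E m) 1, ‖F (r • (θ : E m))‖ ≤ (ε + r ^ 2) * (N * r ^ (κ - 1)) := by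
      intro θ
      have := hFb _ (smul_sphere_mem_ball (hmem' r hr) θ)
        (norm_pos_iff.1 (by rw [norm_smul_sphere hr.1]; exact hr.1))
      rwa [norm_smul_sphere hr.1] at this
    calc _ ≤ ∫ θ : sphere (0 : E m) 1, |w (r • (θ : E m)) * ⟪F (r • (θ : E m)), (θ : E m)⟫| ∂P :=
          abs_integral_le_integral_abs
      _ ≤ ∫ θ : sphere (0 : E m) 1, (ε + r ^ 2) * (N * r ^ (κ - 1)) * |w (r • (θ : E m))| ∂P := by
        refine integral_mono (integrable_sphere ((cw r hr).mul ((cF r hr).inner cθ)).abs)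
          (integrable_sphere (continuous_const.mul (cw r hr).abs)) fun θ => ?_
        simp only
        rw [abs_mul, mul_comm]
        refine mul_le_mul_of_nonneg_right ?_ (abs_nonneg _)
        refine (abs_real_inner_le_norm _ _).trans ?_
        rw [norm_sphere_eq, mul_one]
        exact hFr θ
      _ ≤ _ := by
        rw [integral_const_mul]
        exact mul_le_mul_of_nonneg_left (integral_abs_le_sqrt (cw r hr)) (by positivity)
  · intro r hr ψ δ μ hδ hδ1 hμ
    set f := N * r ^ (κ - 1) with hf
    have hf0 : 0 ≤ f := mul_nonneg hN (Real.rpow_nonneg hr.1.le _)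
    have hA : 0 < ε + r ^ 2 := by positivity
    set D := 1 / 4 + 1 / (4 * δ) + ψ ^ 2 / (2 * μ) + 1 / (2 * μ * r ^ 2) with hD
    have cwg : Continuous fun θ : sphere (0 : E m) 1 =>
      w (r • (θ : E m)) * ⟪gradient w (r • (θ : E m)), (θ : E m)⟫ := (cw r hr).mul ((cgw r hr).inner cθ)
    have cT : Continuous fun θ : sphere (0 : E m) 1 => ‖gradient w (r • (θ : E m))‖ ^ 2
        - ⟪gradient w (r • (θ : E m)), (θ : E m)⟫ ^ 2 :=
      ((cgw r hr).norm.pow 2).sub (((cgw r hr).inner cθ).pow 2)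
    have cw2 : Continuous fun θ : sphere (0 : E m) 1 => w (r • (θ : E m)) ^ 2 := (cw r hr).pow 2
    have i1 : Integrable (fun θ : sphere (0 : E m) 1 =>
        (ε + r ^ 2) * (2 * ψ * (w (r • (θ : E m)) * ⟪gradient w (r • (θ : E m)), (θ : E m)⟫)
          - ψ ^ 2 * w (r • (θ : E m)) ^ 2 + (1 - δ) * (‖gradient w (r • (θ : E m))‖ ^ 2
            - ⟪gradient w (r • (θ : E m)), (θ : E m)⟫ ^ 2) - μ * w (r • (θ : E m)) ^ 2
          - f ^ 2 * D)) P := by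
      refine integrable_sphere ?_
      fun_prop
    have i2 : Integrable (fun θ : sphere (0 : E m) 1 => (ε + r ^ 2) * ‖gradient w (r • (θ : E m))‖ ^ 2
      - ⟪gradient w (r • (θ : E m)), F (r • (θ : E m))⟫ + w (r • (θ : E m)) * G (r • (θ : E m))) P :=
      integrable_sphere (((continuous_const.mul ((cgw r hr).norm.pow 2)).sub
        ((cgw r hr).inner (cF r hr))).add ((cw r hr).mul (cG r hr)))
    have hmono := integral_mono i1 i2 fun θ => by
      have hne : r • (θ : E m) ≠ 0 := norm_pos_iff.1 (by rw [norm_smul_sphere hr.1]; exact hr.1)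
      have hFr := hFb _ (smul_sphere_mem_ball (hmem' r hr) θ) hne
      have hGr := hGb _ (smul_sphere_mem_ball (hmem' r hr) θ) hne
      rw [norm_smul_sphere hr.1] at hFr hGr
      exact energy_lower_bound (norm_sphere_eq θ) hA hr.1 hf0 hFr hGr hδ hμ
    refine le_trans ?_ hmono
    rw [integral_const_mul, integral_linear_combination (integrable_sphere cwg)
      (integrable_sphere cw2) (integrable_sphere cT)]
    refine mul_le_mul_of_nonneg_left ?_ hA.le
    have hpo := integral_sq_le_of_odd hP (hmem r hr) hm hwc he (oddPart_hypRefl e v)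
    have hr2 : 0 < r ^ 2 := by have := hr.1; positivity
    rw [← div_le_iff₀' hr2] at hpo
    have hpo' := mul_le_mul_of_nonneg_left hpo (sub_nonneg.2 hδ1)
    have : ((m : ℝ) - 1) / r ^ 2 * ∫ θ : sphere (0 : E m) 1, w (r • (θ : E m)) ^ 2 ∂P =
      ((m : ℝ) - 1) * (∫ θ : sphere (0 : E m) 1, w (r • (θ : E m)) ^ 2 ∂P) / r ^ 2 := by ring
    rw [this]
    linarith
  · intro r hr
    calc _ ≤ ∫ _ : sphere (0 : E m) 1, K ^ 2 * r ^ 2 ∂P := by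
          refine integral_mono (integrable_sphere ((cw r hr).pow 2)) (integrable_const _) fun θ => ?_
          have := pow_le_pow_left₀ (abs_nonneg _) (hwK r hr θ) 2
          rwa [mul_pow, sq_abs, sq_abs] at this
      _ ≤ _ := by
        rw [integral_const, probReal_univ, one_smul, add_mul]
        have : 0 ≤ |K| * |L| * r ^ 2 := by positivity
        linarith
  · intro r hr
    have hr0 := hr.1
    calc _ ≤ ∫ θ : sphere (0 : E m) 1, |w (r • (θ : E m)) * ⟪U (r • (θ : E m)), (θ : E m)⟫| ∂P :=
          abs_integral_le_integral_abs
      _ ≤ ∫ _ : sphere (0 : E m) 1, |K| * r * |L| ∂P := by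
        refine integral_mono (integrable_sphere ((cw r hr).mul ((cU r hr).inner cθ)).abs)
          (integrable_const _) fun θ => ?_
        simp only
        rw [abs_mul]
        refine mul_le_mul (hwK r hr θ) ?_ (abs_nonneg _) (by positivity)
        refine (abs_real_inner_le_norm _ _).trans ?_
        rw [norm_sphere_eq, mul_one]
        exact (hL _ (hmc r hr θ)).trans (le_abs_self L)
      _ ≤ _ := by
        rw [integral_const, probReal_univ, one_smul]
        have : 0 ≤ K ^ 2 * r := by positivity
        linarith

theorem divg_gradient {R₀ : ℝ} {v : E m → ℝ} (hv : ContDiffOn ℝ 2 v (ball 0 R₀)) {y : E m}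
    (hy : y ∈ ball 0 R₀) : divg (gradient v) y = elap v y := by
  have h1 : DifferentiableAt ℝ (fderiv ℝ v) y :=
    ((hv.fderiv_of_isOpen (m := 1) isOpen_ball (by norm_num)).differentiableOn
      one_ne_zero).differentiableAt (isOpen_ball.mem_nhds hy)
  have h2 : fderiv ℝ (gradient v) y =
      ((InnerProductSpace.toDual ℝ (E m)).symm.toContinuousLinearEquiv.toContinuousLinearMap).comp
        (fderiv ℝ (fderiv ℝ v) y) :=
    ((InnerProductSpace.toDual ℝ (E m)).symm.toContinuousLinearEquiv.hasFDerivAt.comp y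
      h1.hasFDerivAt).fderiv
  unfold divg elap
  refine Finset.sum_congr rfl fun i _ => ?_
  rw [iteratedFDeriv_two_apply, h2]
  have h3 : ∀ z : E m, z i = ⟪z, EuclideanSpace.single i (1 : ℝ)⟫ := fun z => by
    simp [EuclideanSpace.inner_single_right]
  rw [h3]
  exact InnerProductSpace.toDual_symm_apply

theorem divg_sub {U V : E m → E m} {y : E m} (hU : DifferentiableAt ℝ U y)
    (hV : DifferentiableAt ℝ V y) : divg (fun z => U z - V z) y = divg U y - divg V y := by
  unfold divg
  rw [fderiv_fun_sub hU hV, ← Finset.sum_sub_distrib]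
  rfl

theorem divg_smul_gradient_sub {R₀ ε : ℝ} {v : E m → ℝ} {F : E m → E m}
    (hv : ContDiffOn ℝ 2 v (ball 0 R₀)) (hF : ContDiffOn ℝ 1 F (ball 0 R₀)) {y : E m}
    (hy : y ∈ ball 0 R₀) :
    divg (fun y => (ε + ‖y‖ ^ 2) • gradient v y - F y) y
      = (ε + ‖y‖ ^ 2) * elap v y + 2 * ⟪y, gradient v y⟫ - divg F y := by
  have hgv : ContDiffOn ℝ 1 (gradient v) (ball 0 R₀) :=
    (InnerProductSpace.toDual ℝ (E m)).symm.contDiff.comp_contDiffOn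
      (hv.fderiv_of_isOpen isOpen_ball (by norm_num))
  have hgd := (hgv.differentiableOn one_ne_zero).differentiableAt (isOpen_ball.mem_nhds hy)
  have hFd := (hF.differentiableOn one_ne_zero).differentiableAt (isOpen_ball.mem_nhds hy)
  have hA : HasFDerivAt (fun z : E m => ε + ‖z‖ ^ 2) (2 • innerSL ℝ y) y :=
    (hasStrictFDerivAt_norm_sq y).hasFDerivAt.const_add ε
  have hAg : DifferentiableAt ℝ (fun z : E m => (ε + ‖z‖ ^ 2) • gradient v z) y :=
    hA.differentiableAt.smul hgd
  rw [divg_sub hAg hFd, divg_smul hA.differentiableAt hgd,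
    divg_gradient hv hy, ← fderiv_eq_inner_gradient, hA.fderiv]
  simp
  ring

theorem tendsto_integral_sphere [IsFiniteMeasure P] {R₀ : ℝ} (hR₀ : 0 < R₀) {f : E m → ℝ}
    (hf : ContinuousOn f (closedBall 0 R₀)) :
    Tendsto (fun ρ => ∫ θ : sphere (0 : E m) 1, f (ρ • (θ : E m)) ∂P) (𝓝[<] R₀)
      (𝓝 (∫ θ : sphere (0 : E m) 1, f (R₀ • (θ : E m)) ∂P)) := by
  obtain ⟨K, hK⟩ := (isCompact_closedBall (0 : E m) R₀).exists_bound_of_continuousOn hf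
  have hev : ∀ᶠ ρ in 𝓝[<] R₀, ∀ θ : sphere (0 : E m) 1, ρ • (θ : E m) ∈ closedBall (0 : E m) R₀ := by
    filter_upwards [Ioo_mem_nhdsLT hR₀] with ρ hρ θ
    rw [mem_closedBall_zero_iff, norm_smul_sphere hρ.1]
    exact hρ.2.le
  refine tendsto_integral_filter_of_dominated_convergence (fun _ => K) ?_ ?_
    (integrable_const _) ?_
  · filter_upwards [hev] with ρ hρ
    exact (hf.comp_continuous (by fun_prop) hρ).aestronglyMeasurable
  · filter_upwards [hev] with ρ hρ
    exact Eventually.of_forall fun θ => hK _ (hρ θ)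
  · refine Eventually.of_forall fun θ => ?_
    have hc := hf (R₀ • (θ : E m)) (by
      rw [mem_closedBall_zero_iff, norm_smul_sphere hR₀])
    refine hc.tendsto.comp (tendsto_nhdsWithin_iff.2 ⟨?_, ?_⟩)
    · exact (Continuous.tendsto (by fun_prop : Continuous fun ρ : ℝ => ρ • (θ : E m)) R₀).mono_left
        nhdsWithin_le_nhds
    · filter_upwards [hev] with ρ hρ using hρ θ

theorem continuousOn_oddPart {R₀ : ℝ} {v : E m → ℝ} (hv : ContinuousOn v (closedBall 0 R₀)) (e : E m) :
    ContinuousOn (oddPart e v) (closedBall 0 R₀) := by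
  refine (hv.sub (hv.comp (hypRefl e).continuous.continuousOn fun y hy => ?_)).div_const 2
  rw [mem_closedBall_zero_iff, LinearIsometryEquiv.norm_map]
  exact mem_closedBall_zero_iff.1 hy

/-- Decay, uniform in `ε`, of the parts of a solution that are odd under reflections. -/
theorem exists_integral_sq_oddPart_le (hm : 1 ≤ m) {γ α κ R₀ : ℝ} (hα0 : 0 < α)
    (hα : α ^ 2 + m * α = m - 1 + 2 / γ) (hκ0 : 0 < κ) (hR₀ : 0 < R₀) (hκ : κ ≠ min α 1) :
    ∃ C > 0, ∀ P : Measure (sphere (0 : E m) 1), IsRotInv P →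
      ∀ ε N : ℝ, ∀ (v G : E m → ℝ) (F : E m → E m), 0 < ε → 0 ≤ N →
        ContDiffOn ℝ 2 v (ball 0 R₀) → ContinuousOn v (closedBall 0 R₀) →
        ContDiffOn ℝ 1 F (ball 0 R₀) → ContinuousOn G (ball 0 R₀) →
        (∀ y ∈ ball (0 : E m) R₀, (ε + ‖y‖ ^ 2) * elap v y + 2 * ⟪y, gradient v y⟫ - 2 / γ * v y
          = divg F y + G y) →
        (∀ y ∈ ball (0 : E m) R₀, y ≠ 0 → ‖F y‖ ≤ (ε + ‖y‖ ^ 2) * (N * ‖y‖ ^ (κ - 1))) →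
        (∀ y ∈ ball (0 : E m) R₀, y ≠ 0 → |G y| ≤ (ε + ‖y‖ ^ 2) * (N * ‖y‖ ^ (κ - 1) / ‖y‖)) →
        ∀ e : E m, ‖e‖ = 1 → ∀ R ∈ Ioo 0 (R₀ / 2),
          ∫ θ : sphere (0 : E m) 1, oddPart e v (R • (θ : E m)) ^ 2 ∂P ≤
            C * (R ^ min (min α 1) κ) ^ 2 *
            ((∫ θ : sphere (0 : E m) 1, oddPart e v (R₀ • (θ : E m)) ^ 2 ∂P) + N ^ 2) := by
  obtain ⟨c, Cφ, Cκ, CΘ, C₁, c₂, hc, hCφ, hCκ, -, hC₁, hc₂, hbar⟩ :=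
    exists_isBarrier (by exact_mod_cast hm) hα0 hα hκ0 hR₀ hκ
  obtain ⟨C, hC, hmain⟩ := integral_sq_oddPart_le hm (γ := γ) (κ := κ) (R₀ := R₀) (CΘ := CΘ) hc hCφ hCκ
  refine ⟨C * C₁ ^ 2 * (1 / c₂ ^ 2 + 1), by positivity, ?_⟩
  intro P hP ε N v G F hε hN hv hvc hF hG heq hFb hGb e he R hR
  have := hP.isProb
  obtain ⟨φ, φ', φ'', Θ, θ', hB, hφR, hφ⟩ := hbar R hR.1
  have hdiv : ∀ y ∈ ball (0 : E m) R₀,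
      divg (fun y => (ε + ‖y‖ ^ 2) • gradient v y - F y) y = 2 / γ * v y + G y := by
    intro y hy
    rw [divg_smul_gradient_sub hv hF hy]
    linarith [heq y hy]
  have hlim := tendsto_integral_sphere (P := P) hR₀ ((continuousOn_oddPart hvc e).pow 2)
  refine ge_of_tendsto ((hlim.add_const (N ^ 2)).const_mul
    (C * C₁ ^ 2 * (1 / c₂ ^ 2 + 1) * (R ^ min (min α 1) κ) ^ 2)) ?_
  filter_upwards [Ioo_mem_nhdsLT (half_lt_self hR₀)] with ρ hρ
  have h := hmain φ φ' φ'' Θ θ' hB P hP ε ρ N v G F hε hN (by linarith [hρ.1]) hρ.2 hv hF hG hdiv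
    hFb hGb e he R ⟨hR.1, by linarith [hρ.1, hR.2]⟩
  refine h.trans ?_
  have hφ0 : 0 ≤ φ R := (hB.pos R ⟨hR.1, by linarith [hR.2]⟩).le
  have hφρ := hφ ρ ⟨hρ.1.le, hρ.2.le⟩
  have hH : 0 ≤ ∫ θ : sphere (0 : E m) 1, oddPart e v (ρ • (θ : E m)) ^ 2 ∂P :=
    integral_nonneg fun θ => sq_nonneg _
  have h1 : φ R ^ 2 ≤ C₁ ^ 2 * (R ^ min (min α 1) κ) ^ 2 := by
    rw [← mul_pow]; exact pow_le_pow_left₀ hφ0 hφR 2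
  have h2 : (∫ θ : sphere (0 : E m) 1, oddPart e v (ρ • (θ : E m)) ^ 2 ∂P) / φ ρ ^ 2 ≤
      (∫ θ : sphere (0 : E m) 1, oddPart e v (ρ • (θ : E m)) ^ 2 ∂P) * (1 / c₂ ^ 2) := by
    rw [div_eq_mul_one_div]
    refine mul_le_mul_of_nonneg_left ?_ hH
    exact one_div_le_one_div_of_le (by positivity) (pow_le_pow_left₀ hc₂.le hφρ 2)
  calc _ ≤ C * (C₁ ^ 2 * (R ^ min (min α 1) κ) ^ 2) *
        (((∫ θ : sphere (0 : E m) 1, oddPart e v (ρ • (θ : E m)) ^ 2 ∂P) + N ^ 2)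
          * (1 / c₂ ^ 2 + 1)) := by
        refine mul_le_mul (mul_le_mul_of_nonneg_left h1 hC.le) ?_ (by positivity) (by positivity)
        have : 0 ≤ N ^ 2 * (1 / c₂ ^ 2) := by positivity
        linarith
    _ = _ := by simp only [Pi.pow_apply]; ring

theorem isometry_mem_sphere (L : E m ≃ₗᵢ[ℝ] E m) (θ : sphere (0 : E m) 1) :
    L θ ∈ sphere (0 : E m) 1 := by
  simp

theorem continuous_comp_isometry {h : E m → ℝ} (hh : ContinuousOn h (sphere 0 1))
    (L : E m ≃ₗᵢ[ℝ] E m) : Continuous fun θ : sphere (0 : E m) 1 => h (L θ) :=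
  hh.comp_continuous (L.continuous.comp continuous_subtype_val) (isometry_mem_sphere L)

theorem integral_sq_sub_hypRefl_le {h : E m → ℝ} {b : ℝ} (hb : 0 ≤ b)
    (hunit : ∀ e : E m, ‖e‖ = 1 →
      ∫ θ : sphere (0 : E m) 1, (h (hypRefl e θ) - h θ) ^ 2 ∂P ≤ b) (e : E m) :
    ∫ θ : sphere (0 : E m) 1, (h (hypRefl e θ) - h θ) ^ 2 ∂P ≤ b := by
  by_cases he : e = 0
  · subst he
    have h0 : ∀ y : E m, hypRefl 0 y = y := fun y =>
      Submodule.reflection_mem_subspace_eq_self (by simp)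
    simpa [h0] using hb
  · have h1 : hypRefl e = hypRefl (‖e‖⁻¹ • e) := by
      have hn : IsUnit ‖e‖⁻¹ := (inv_ne_zero (norm_ne_zero_iff.2 he)).isUnit
      unfold hypRefl
      congr 2
      exact (Submodule.span_singleton_smul_eq hn e).symm
    rw [h1]
    exact hunit _ (norm_smul_inv_norm he)

theorem integral_sq_sub_prod_le (hP : IsRotInv P) {h : E m → ℝ} (hh : ContinuousOn h (sphere 0 1))
    {b : ℝ} (hb : ∀ e : E m, ∫ θ : sphere (0 : E m) 1, (h (hypRefl e θ) - h θ) ^ 2 ∂P ≤ b)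
    (l : List (E m)) :
    ∫ θ : sphere (0 : E m) 1, (h ((l.map hypRefl).prod θ) - h θ) ^ 2 ∂P
      ≤ 2 * (2 ^ l.length - 1) * b := by
  have := hP.isProb
  induction l with
  | nil => simp
  | cons v l ih =>
    set L := (l.map hypRefl).prod with hL
    have c0 : Continuous fun θ : sphere (0 : E m) 1 => h θ :=
      hh.comp_continuous continuous_subtype_val fun θ => θ.2
    have c1 := continuous_comp_isometry hh L
    have c2 := continuous_comp_isometry hh (hypRefl v * L)
    have i1 : Integrable (fun θ : sphere (0 : E m) 1 =>
      2 * (h ((hypRefl v * L) θ) - h (L θ)) ^ 2) P :=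
      integrable_sphere (continuous_const.mul ((c2.sub c1).pow 2))
    have i2 : Integrable (fun θ : sphere (0 : E m) 1 => 2 * (h (L θ) - h θ) ^ 2) P :=
      integrable_sphere (continuous_const.mul ((c1.sub c0).pow 2))
    have hinv := hP.integral_comp L (fun y => (h (hypRefl v y) - h y) ^ 2)
    have hbv := hb v
    rw [← hinv] at hbv
    calc _ ≤ ∫ θ : sphere (0 : E m) 1, (2 * (h ((hypRefl v * L) θ) - h (L θ)) ^ 2
          + 2 * (h (L θ) - h θ) ^ 2) ∂P := by
          refine integral_mono (integrable_sphere ?_) (i1.add i2) fun θ => ?_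
          · rw [List.map_cons, List.prod_cons]
            exact (c2.sub c0).pow 2
          · simp only [List.map_cons, List.prod_cons]
            rw [← hL]
            nlinarith [sq_nonneg ((h ((hypRefl v * L) θ) - h (L θ)) - (h (L θ) - h θ))]
      _ = 2 * ∫ θ : sphere (0 : E m) 1, (h (hypRefl v (L θ)) - h (L θ)) ^ 2 ∂P
          + 2 * ∫ θ : sphere (0 : E m) 1, (h (L θ) - h θ) ^ 2 ∂P := by
          rw [integral_add i1 i2, integral_const_mul, integral_const_mul]
          rfl
      _ ≤ 2 * b + 2 * (2 * (2 ^ l.length - 1) * b) := by linarith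
      _ = _ := by rw [List.length_cons, pow_succ]; ring

theorem integral_sq_sub_isometry_le (hP : IsRotInv P) {h : E m → ℝ}
    (hh : ContinuousOn h (sphere 0 1)) {b : ℝ} (hb0 : 0 ≤ b)
    (hb : ∀ e : E m, ‖e‖ = 1 →
      ∫ θ : sphere (0 : E m) 1, (h (hypRefl e θ) - h θ) ^ 2 ∂P ≤ b) (L : E m ≃ₗᵢ[ℝ] E m) :
    ∫ θ : sphere (0 : E m) 1, (h (L θ) - h θ) ^ 2 ∂P ≤ 2 * 2 ^ m * b := by
  obtain ⟨l, hl, rfl⟩ := L.reflections_generate_dim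
  refine (integral_sq_sub_prod_le hP hh (integral_sq_sub_hypRefl_le hb0 hb) l).trans ?_
  refine mul_le_mul_of_nonneg_right ?_ hb0
  have : (2 : ℝ) ^ l.length ≤ 2 ^ m :=
    pow_le_pow_right₀ one_le_two (by simpa using hl)
  linarith

/-- A function whose translates under a transitive action of a compact group are all close to it
in mean square is close to its mean. -/
theorem variance_le_of_transitive {X Γ : Type*} [TopologicalSpace X] [CompactSpace X]
    [FirstCountableTopology X] [LocallyCompactSpace X]
    [MeasurableSpace X] [BorelSpace X] [Group Γ] [TopologicalSpace Γ] [IsTopologicalGroup Γ]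
    [CompactSpace Γ] {P : Measure X} [IsProbabilityMeasure P] {ρ : Γ → X → X}
    (hρ : Continuous fun p : Γ × X => ρ p.1 p.2)
    (hmul : ∀ g k x, ρ (g * k) x = ρ g (ρ k x)) (htrans : ∀ x y, ∃ g, ρ g x = y) {h : X → ℝ}
    (hh : Continuous h) (hinv : ∀ g, ∫ x, h (ρ g x) ∂P = ∫ x, h x ∂P) {b : ℝ}
    (hb : ∀ g, ∫ x, (h (ρ g x) - h x) ^ 2 ∂P ≤ b) :
    ∫ x, (h x - ∫ x, h x ∂P) ^ 2 ∂P ≤ b := by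
  let _ : MeasurableSpace Γ := borel _
  have : BorelSpace Γ := ⟨rfl⟩
  set μ : Measure Γ := Measure.haarMeasure ⊤ with hμ
  have : IsProbabilityMeasure μ := ⟨by
    simpa using Measure.haarMeasure_self (K₀ := (⊤ : TopologicalSpace.PositiveCompacts Γ))⟩
  have ig : ∀ {f : Γ → ℝ}, Continuous f → Integrable f μ := fun hf =>
    hf.integrable_of_hasCompactSupport (HasCompactSupport.of_compactSpace _)
  have iP : ∀ {f : X → ℝ}, Continuous f → Integrable f P := fun hf =>
    hf.integrable_of_hasCompactSupport (HasCompactSupport.of_compactSpace _)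
  have cρ : Continuous fun p : X × Γ => ρ p.2⁻¹ p.1 :=
    hρ.comp (f := fun p : X × Γ => (p.2⁻¹, p.1)) (by fun_prop)
  have ch : Continuous fun p : X × Γ => h (ρ p.2⁻¹ p.1) := hh.comp cρ
  have cs : Continuous fun p : X × Γ => (h p.1 - h (ρ p.2⁻¹ p.1)) ^ 2 :=
    ((hh.comp continuous_fst).sub ch).pow 2
  have cslice : ∀ x, Continuous fun g => h (ρ g⁻¹ x) := fun x =>
    ch.comp (f := fun g : Γ => (x, g)) (by fun_prop)
  set a : X → ℝ := fun x => ∫ g, h (ρ g⁻¹ x) ∂μ with ha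
  have hainv : ∀ k x, a (ρ k x) = a x := by
    intro k x
    simp only [ha]
    rw [← integral_mul_left_eq_self (μ := μ) (fun g => h (ρ g⁻¹ (ρ k x))) k]
    refine integral_congr_ae (Eventually.of_forall fun g => ?_)
    simp only [← hmul]
    simp
  have hswap : ∫ x, a x ∂P = ∫ x, h x ∂P := by
    simp only [ha]
    rw [integral_integral_swap_of_hasCompactSupport ch (HasCompactSupport.of_compactSpace _)]
    simp only [hinv]
    simp
  have hconst : ∀ x, a x = ∫ x, h x ∂P := by
    intro x
    rw [← hswap]
    have : ∀ y, a y = a x := fun y => by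
      obtain ⟨g, rfl⟩ := htrans x y
      exact hainv g x
    simp [this]
  have cinner : Continuous fun x => ∫ g, (h x - h (ρ g⁻¹ x)) ^ 2 ∂μ := by
    have := continuous_parametric_integral_of_continuous (μ := μ) (s := univ)
      (f := fun x g => (h x - h (ρ g⁻¹ x)) ^ 2) cs isCompact_univ
    simpa using this
  calc _ ≤ ∫ x, ∫ g, (h x - h (ρ g⁻¹ x)) ^ 2 ∂μ ∂P := by
        refine integral_mono (iP ((hh.sub continuous_const).pow 2)) (iP cinner) fun x => ?_
        simp only
        have h1 : h x - ∫ x, h x ∂P = ∫ g, (h x - h (ρ g⁻¹ x)) ∂μ := by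
          rw [integral_sub (integrable_const _) (ig (cslice x)), ← hconst x]
          simp [ha]
        rw [h1]
        have c1 : Continuous fun g => h x - h (ρ g⁻¹ x) := continuous_const.sub (cslice x)
        exact sq_integral_le (ig c1) (ig (c1.pow 2))
    _ = ∫ g, ∫ x, (h x - h (ρ g⁻¹ x)) ^ 2 ∂P ∂μ :=
        integral_integral_swap_of_hasCompactSupport cs (HasCompactSupport.of_compactSpace _)
    _ ≤ ∫ _, b ∂μ := by
        refine integral_mono_of_nonneg
          (Eventually.of_forall fun g => integral_nonneg fun x => sq_nonneg _)
          (integrable_const b) (Eventually.of_forall fun g => ?_)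
        have := hb g⁻¹
        simp only [← neg_sub (h _) (h (ρ g⁻¹ _)), neg_sq] at this ⊢
        exact this
    _ = b := by simp

theorem continuousStar_clm : ContinuousStar (E m →L[ℝ] E m) :=
  ⟨(ContinuousLinearMap.adjoint (𝕜 := ℝ) (E := E m) (F := E m)).continuous⟩

theorem compactSpace_unitary : CompactSpace (unitary (E m →L[ℝ] E m)) := by
  have : ProperSpace (E m →L[ℝ] E m) := FiniteDimensional.proper ℝ _
  have := continuousStar_clm (m := m)
  refine isCompact_iff_compactSpace.1 (Metric.isCompact_of_isClosed_isBounded isClosed_unitary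
    (isBounded_iff_forall_norm_le.2 ⟨1, fun u hu => ?_⟩))
  refine ContinuousLinearMap.opNorm_le_bound _ zero_le_one fun x => ?_
  have := (Unitary.linearIsometryEquiv ⟨u, hu⟩).norm_map x
  rw [one_mul]
  exact this.le

/-- A function whose rotations are all close to it in mean square is close to its mean. -/
theorem variance_le (hP : IsRotInv P) {h : E m → ℝ} (hh : ContinuousOn h (sphere 0 1)) {b : ℝ}
    (hb : ∀ L : E m ≃ₗᵢ[ℝ] E m, ∫ θ : sphere (0 : E m) 1, (h (L θ) - h θ) ^ 2 ∂P ≤ b) :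
    ∫ θ : sphere (0 : E m) 1, (h θ - ∫ θ : sphere (0 : E m) 1, h θ ∂P) ^ 2 ∂P ≤ b := by
  have := hP.isProb
  have := continuousStar_clm (m := m)
  have := compactSpace_unitary (m := m)
  refine variance_le_of_transitive (Γ := unitary (E m →L[ℝ] E m))
    (ρ := fun g θ => ⟨Unitary.linearIsometryEquiv g θ, isometry_mem_sphere _ θ⟩) ?_ ?_ ?_
    (h := fun θ : sphere (0 : E m) 1 => h θ) ?_ ?_ ?_
  · refine Continuous.subtype_mk ?_ _
    have h1 : Continuous fun p : unitary (E m →L[ℝ] E m) × sphere (0 : E m) 1 =>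
        (p.1 : E m →L[ℝ] E m) := continuous_subtype_val.comp continuous_fst
    exact h1.clm_apply (continuous_subtype_val.comp continuous_snd)
  · intro g k θ
    simp
  · intro θ η
    refine ⟨Unitary.linearIsometryEquiv.symm (hypRefl ((θ : E m) - η)), Subtype.ext ?_⟩
    simp only [MulEquiv.apply_symm_apply]
    rw [hypRefl, Submodule.reflection_sub (by simp)]
  · exact hh.comp_continuous continuous_subtype_val fun θ => θ.2
  · exact fun g => hP.integral_comp _ _
  · exact fun g => hb _

/-- The normalized Hausdorff measure on the unit sphere. -/
noncomputable def sphereMeasure (m : ℕ) : Measure (sphere (0 : E m) 1) :=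
  ((μH[(m : ℝ) - 1] : Measure (sphere (0 : E m) 1)) univ)⁻¹ • μH[(m : ℝ) - 1]

theorem integral_sphere_hausdorff (hm : 1 ≤ m) (f : E m → ℝ) :
    ∫ θ : sphere (0 : E m) 1, f θ ∂μH[(m : ℝ) - 1]
      = ∫ x in sphere (0 : E m) 1, f x ∂μH[(m : ℝ) - 1] := by
  have hd : (0 : ℝ) ≤ m - 1 := by
    have : (1 : ℝ) ≤ m := by exact_mod_cast hm
    linarith
  have h := (isometry_subtype_coe (s := sphere (0 : E m) 1)).map_hausdorffMeasure
    (d := (m : ℝ) - 1) (Or.inl hd)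
  rw [Subtype.range_coe] at h
  rw [← h, (MeasurableEmbedding.subtype_coe isClosed_sphere.measurableSet).integral_map]

theorem sphere_hausdorff_univ (hm : 1 ≤ m) :
    (μH[(m : ℝ) - 1] : Measure (sphere (0 : E m) 1)) univ
      = μH[(m : ℝ) - 1] (sphere (0 : E m) 1) := by
  have hd : (0 : ℝ) ≤ m - 1 := by
    have : (1 : ℝ) ≤ m := by exact_mod_cast hm
    linarith
  have h := (isometry_subtype_coe (s := sphere (0 : E m) 1)).hausdorffMeasure_image
    (d := (m : ℝ) - 1) (Or.inl hd) univ
  rw [← h, image_univ, Subtype.range_coe]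

theorem setAverage_sphere (hm : 1 ≤ m) {ρ : ℝ} (hρ : 0 < ρ) (f : E m → ℝ) :
    ⨍ x in sphere (0 : E m) ρ, f x ∂μH[(m : ℝ) - 1]
      = ∫ θ : sphere (0 : E m) 1, f (ρ • θ) ∂sphereMeasure m := by
  have hd : (0 : ℝ) ≤ m - 1 := by
    have : (1 : ℝ) ≤ m := by exact_mod_cast hm
    linarith
  have hmap := map_homothety_hausdorffMeasure (𝕜 := ℝ) hd (0 : E m) hρ.ne'
  have hfun : ⇑(AffineMap.homothety (0 : E m) ρ) = fun y : E m => ρ • y := by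
    ext1 y
    simp [AffineMap.homothety_apply]
  rw [hfun] at hmap
  have hemb : MeasurableEmbedding fun y : E m => ρ • y :=
    measurableEmbedding_const_smul₀ hρ.ne'
  have hpre : (fun y : E m => ρ • y) ⁻¹' sphere 0 ρ = sphere 0 1 := by
    ext y
    simp [norm_smul, abs_of_pos hρ, hρ.ne']
  set c : NNReal := ‖ρ‖₊⁻¹ ^ ((m : ℝ) - 1) with hc
  have hc0 : (c : ℝ) ≠ 0 := by
    rw [hc]
    have : (0 : ℝ) < ‖ρ‖ := norm_pos_iff.2 hρ.ne'
    push_cast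
    positivity
  have h1 : ∫ x in sphere (0 : E m) 1, f (ρ • x) ∂μH[(m : ℝ) - 1]
      = c * ∫ x in sphere (0 : E m) ρ, f x ∂μH[(m : ℝ) - 1] := by
    rw [← hpre, ← hemb.setIntegral_map, hmap, Measure.restrict_smul, integral_smul_nnreal_measure]
    rfl
  have h2 : (μH[(m : ℝ) - 1] : Measure (E m)).real (sphere 0 1)
      = c * (μH[(m : ℝ) - 1] : Measure (E m)).real (sphere 0 ρ) := by
    rw [← hpre, ← map_measureReal_apply hemb.measurable isClosed_sphere.measurableSet, hmap,
      measureReal_nnreal_smul_apply]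
  rw [setAverage_eq, sphereMeasure, integral_smul_measure,
    integral_sphere_hausdorff hm fun x => f (ρ • x), sphere_hausdorff_univ hm, ENNReal.toReal_inv,
    ← measureReal_def, h1, h2, smul_eq_mul, smul_eq_mul]
  field_simp

theorem isRotInv_sphereMeasure (hm : 1 ≤ m) (h : sphereMeasure m ≠ 0) :
    IsRotInv (sphereMeasure m) where
  isProb := by
    refine ⟨?_⟩
    rw [sphereMeasure, Measure.smul_apply, smul_eq_mul]
    refine ENNReal.inv_mul_cancel (fun h0 => h ?_) fun h0 => h ?_
    · rw [sphereMeasure, Measure.measure_univ_eq_zero.1 h0, smul_zero]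
    · rw [sphereMeasure, h0, ENNReal.inv_top, zero_smul]
  integral_comp L f := by
    rw [sphereMeasure, integral_smul_measure, integral_smul_measure,
      integral_sphere_hausdorff hm fun x => f (L x), integral_sphere_hausdorff hm]
    congr 1
    have hpre : L ⁻¹' sphere (0 : E m) 1 = sphere 0 1 := by
      ext y
      simp
    have := (L.toIsometryEquiv.measurePreserving_hausdorffMeasure
      ((m : ℝ) - 1)).setIntegral_preimage_emb L.toHomeomorph.measurableEmbedding f (sphere 0 1)
    change ∫ x in L ⁻¹' sphere (0 : E m) 1, f (L x) ∂μH[(m : ℝ) - 1] = _ at this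
    rwa [hpre] at this

theorem sDev_sq (hm : 1 ≤ m) {ρ : ℝ} (hρ : 0 < ρ) (w : E m → ℝ) :
    sDev ρ w ^ 2 = ∫ θ : sphere (0 : E m) 1, (w (ρ • θ)
      - ∫ θ : sphere (0 : E m) 1, w (ρ • θ) ∂sphereMeasure m) ^ 2 ∂sphereMeasure m := by
  rw [sDev, setAverage_sphere hm hρ, sAvg, setAverage_sphere hm hρ, Real.sq_sqrt]
  exact integral_nonneg fun θ => sq_nonneg _

theorem continuousOn_comp_smul {r R₀ : ℝ} (hr : 0 ≤ r) (hrR : r ≤ R₀) {v : E m → ℝ}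
    (hv : ContinuousOn v (closedBall 0 R₀)) :
    ContinuousOn (fun y : E m => v (r • y)) (sphere 0 1) := by
  refine hv.comp (by fun_prop) fun y hy => ?_
  rw [mem_closedBall_zero_iff, norm_smul, mem_sphere_zero_iff_norm.1 hy, mul_one,
    Real.norm_of_nonneg hr]
  exact hrR

theorem integral_sq_oddPart_le_integral_sq_sub (hP : IsRotInv P) {R₀ : ℝ} (hR₀ : 0 ≤ R₀)
    {v : E m → ℝ} (hv : ContinuousOn v (closedBall 0 R₀)) (e : E m) (c : ℝ) :
    ∫ θ : sphere (0 : E m) 1, oddPart e v (R₀ • (θ : E m)) ^ 2 ∂P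
      ≤ ∫ θ : sphere (0 : E m) 1, (v (R₀ • (θ : E m)) - c) ^ 2 ∂P := by
  have := hP.isProb
  have hs := continuousOn_comp_smul hR₀ le_rfl hv
  have c0 : Continuous fun θ : sphere (0 : E m) 1 => v (R₀ • (θ : E m)) :=
    hs.comp_continuous continuous_subtype_val fun θ => θ.2
  have c1 := continuous_comp_isometry hs (hypRefl e)
  have co : Continuous fun θ : sphere (0 : E m) 1 => oddPart e v (R₀ • (θ : E m)) :=
    (continuousOn_comp_smul hR₀ le_rfl (continuousOn_oddPart hv e)).comp_continuous
      continuous_subtype_val fun θ => θ.2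
  have i0 : Integrable (fun θ : sphere (0 : E m) 1 => (v (R₀ • (θ : E m)) - c) ^ 2 / 2) P :=
    integrable_sphere (((c0.sub continuous_const).pow 2).div_const 2)
  have i1 : Integrable
      (fun θ : sphere (0 : E m) 1 => (v (R₀ • hypRefl e (θ : E m)) - c) ^ 2 / 2) P :=
    integrable_sphere (((c1.sub continuous_const).pow 2).div_const 2)
  have hinv := hP.integral_comp (hypRefl e) fun y => (v (R₀ • y) - c) ^ 2 / 2
  calc _ ≤ ∫ θ : sphere (0 : E m) 1, ((v (R₀ • (θ : E m)) - c) ^ 2 / 2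
        + (v (R₀ • hypRefl e (θ : E m)) - c) ^ 2 / 2) ∂P := by
        refine integral_mono (integrable_sphere (co.pow 2)) (i0.add i1) fun θ => ?_
        simp only [oddPart, map_smul]
        nlinarith [sq_nonneg ((v (R₀ • (θ : E m)) - c) + (v (R₀ • hypRefl e (θ : E m)) - c))]
    _ = _ := by
        rw [integral_add i0 i1, hinv, ← integral_add i0 i0]
        simp only [add_halves]

theorem rpow_mul_rpow_le {ε r σ s : ℝ} (hε : 0 < ε) (hr : 0 < r) (hs : 0 ≤ s) :
    r ^ σ * (ε + r ^ 2) ^ (1 - s) ≤ (ε + r ^ 2) * r ^ (σ - 2 * s) := by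
  have hA : 0 < ε + r ^ 2 := by positivity
  have h1 : (ε + r ^ 2) ^ (-s) ≤ (r ^ 2) ^ (-s) :=
    Real.rpow_le_rpow_of_nonpos (by positivity) (by linarith) (by linarith)
  have h2 : (r ^ 2 : ℝ) ^ (-s) = r ^ (-(2 * s)) := by
    rw [← Real.rpow_natCast, ← Real.rpow_mul hr.le]
    norm_num
  calc r ^ σ * (ε + r ^ 2) ^ (1 - s) = (ε + r ^ 2) * (r ^ σ * (ε + r ^ 2) ^ (-s)) := by
        rw [sub_eq_add_neg, Real.rpow_add hA, Real.rpow_one]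
        ring
    _ ≤ (ε + r ^ 2) * (r ^ σ * r ^ (-(2 * s))) := by
        rw [← h2]
        gcongr
    _ = _ := by rw [← Real.rpow_add hr, sub_eq_add_neg]

theorem indicial_root {m γ : ℝ} (hm : 1 ≤ m) (hγ : 0 < γ) :
    0 < (-m + √(m ^ 2 + 4 * (m - 1 + 2 / γ))) / 2 ∧
      ((-m + √(m ^ 2 + 4 * (m - 1 + 2 / γ))) / 2) ^ 2
        + m * ((-m + √(m ^ 2 + 4 * (m - 1 + 2 / γ))) / 2) = m - 1 + 2 / γ := by
  have h0 : 0 < 2 / γ := by positivity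
  have h1 : m < √(m ^ 2 + 4 * (m - 1 + 2 / γ)) := Real.lt_sqrt_of_sq_lt (by linarith)
  have h2 := Real.sq_sqrt (show 0 ≤ m ^ 2 + 4 * (m - 1 + 2 / γ) by nlinarith)
  exact ⟨by linarith, by linear_combination h2 / 4⟩

theorem exists_mem_ball_ne_zero (hm : 1 ≤ m) {R₀ : ℝ} (hR₀ : 0 < R₀) :
    ∃ y ∈ ball (0 : E m) R₀, y ≠ 0 := by
  have : Nonempty (Fin m) := ⟨⟨0, hm⟩⟩
  obtain ⟨y, hy⟩ := exists_norm_eq (E m) (half_pos hR₀).le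
  refine ⟨y, by rw [mem_ball_zero_iff, hy]; linarith, fun h => ?_⟩
  rw [h, norm_zero] at hy
  linarith

end

end

/-- Proposition 6.1 (oscillation decay for the inhomogeneous reduced equation). -/
theorem oscillation_decay (m : ℕ) (hm : 1 ≤ m) (γ σ s R0 : ℝ)
    (hγ : 0 < γ) (hσ : 0 < σ) (hs0 : 0 ≤ s) (hs : s ≤ 1/2) (hR0 : 0 < R0)
    (hne : 1 + σ - 2*s ≠
      min ((-(m:ℝ) + Real.sqrt ((m:ℝ)^2 + 4*((m:ℝ) - 1 + 2/γ)))/2) 1) :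
    ∃ C : ℝ, 0 < C ∧ ∀ ε : ℝ, 0 < ε →
      ∀ (F : E m → E m) (G : E m → ℝ) (vb : E m → ℝ),
      ContDiffOn ℝ 1 F (ball (0 : E m) R0) →
      ContinuousOn G (ball (0 : E m) R0) →
      ContDiffOn ℝ 2 vb (ball (0 : E m) R0) →
      ContinuousOn vb (closure (ball (0 : E m) R0)) →
      (∀ y ∈ ball (0 : E m) R0,
        (ε + ‖y‖^2) * elap vb y + 2 * ⟪y, gradient vb y⟫ - (2/γ) * vb y
          = divg F y + G y) →
      ∀ NF NG : ℝ,
      (∀ y ∈ ball (0 : E m) R0, ‖F y‖ ≤ NF * (‖y‖ ^ σ * (ε + ‖y‖^2) ^ (1 - s))) →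
      (∀ y ∈ ball (0 : E m) R0, y ≠ 0 →
          |G y| ≤ NG * (‖y‖ ^ (σ - 1) * (ε + ‖y‖^2) ^ (1 - s))) →
      ∀ R ∈ Set.Ioo (0:ℝ) (R0/2),
        sDev R vb ≤ C * (NF + NG + sDev R0 vb) *
          R ^ (min (min ((-(m:ℝ) + Real.sqrt ((m:ℝ)^2 + 4*((m:ℝ) - 1 + 2/γ)))/2) 1)
                (1 + σ - 2*s)) := by
  have hκ0 : 0 < 1 + σ - 2 * s := by linarith
  obtain ⟨hα0, hα⟩ := indicial_root (show (1 : ℝ) ≤ m by exact_mod_cast hm) hγ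
  set α := (-(m : ℝ) + √((m : ℝ) ^ 2 + 4 * ((m : ℝ) - 1 + 2 / γ))) / 2
  set κ := 1 + σ - 2 * s with hκ
  obtain ⟨C, hC, hmain⟩ := exists_integral_sq_oddPart_le hm hα0 hα hκ0 hR0 hne
  refine ⟨√(8 * 2 ^ m * C), Real.sqrt_pos.2 (by positivity), ?_⟩
  intro ε hε F G v hF hG hv hvc heq NF NG hFb hGb R hR
  have hR' : 0 < R := hR.1
  have hS0 : 0 ≤ sDev R0 v := Real.sqrt_nonneg _
  have hS : 0 ≤ sDev R v := Real.sqrt_nonneg _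
  obtain ⟨y₀, hy₀, hy₀0⟩ := exists_mem_ball_ne_zero hm hR0
  have hpos : 0 < ‖y₀‖ := norm_pos_iff.2 hy₀0
  have hNF : 0 ≤ NF := nonneg_of_mul_nonneg_left ((norm_nonneg _).trans (hFb y₀ hy₀))
    (by positivity)
  have hNG : 0 ≤ NG := nonneg_of_mul_nonneg_left ((abs_nonneg _).trans (hGb y₀ hy₀ hy₀0))
    (by positivity)
  by_cases h0 : sphereMeasure m = 0
  · have hz : sDev R v ^ 2 = 0 := by rw [sDev_sq hm hR', h0]; simp
    rw [pow_eq_zero_iff two_ne_zero] at hz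
    rw [hz]
    positivity
  have hP := isRotInv_sphereMeasure hm h0
  rw [closure_ball _ hR0.ne'] at hvc
  have hodd := hmain (sphereMeasure m) hP ε (NF + NG) v G F hε (by positivity) hv hvc hF hG heq
    (fun y hy hy0 => ?_) (fun y hy hy0 => ?_)
  · have hh := continuousOn_comp_smul hR'.le (by linarith [hR.2]) hvc
    have hvar : sDev R v ^ 2 ≤ 2 * 2 ^ m * (4 * (C * (R ^ min (min α 1) κ) ^ 2 *
        (sDev R0 v ^ 2 + (NF + NG) ^ 2))) := by
      rw [sDev_sq hm hR']
      refine variance_le hP hh (integral_sq_sub_isometry_le hP hh (by positivity) fun e he => ?_)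
      have h1 := hodd e he R hR
      have h2 := integral_sq_oddPart_le_integral_sq_sub hP hR0.le hvc e
        (∫ θ : sphere (0 : E m) 1, v (R0 • (θ : E m)) ∂sphereMeasure m)
      rw [← sDev_sq hm hR0] at h2
      have h3 : ∫ θ : sphere (0 : E m) 1, (v (R • hypRefl e (θ : E m)) - v (R • (θ : E m))) ^ 2
          ∂sphereMeasure m
          = 4 * ∫ θ : sphere (0 : E m) 1, oddPart e v (R • (θ : E m)) ^ 2 ∂sphereMeasure m := by
        rw [← integral_const_mul]
        refine integral_congr_ae (Filter.Eventually.of_forall fun θ => ?_)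
        simp only [oddPart, map_smul]
        ring
      rw [h3]
      gcongr
      refine h1.trans ?_
      gcongr
    refine (pow_le_pow_iff_left₀ hS (by positivity) two_ne_zero).1 (hvar.trans ?_)
    rw [mul_pow, mul_pow, Real.sq_sqrt (by positivity)]
    have h4 : sDev R0 v ^ 2 + (NF + NG) ^ 2 ≤ (NF + NG + sDev R0 v) ^ 2 := by
      nlinarith [mul_nonneg (add_nonneg hNF hNG) hS0]
    calc _ = 8 * 2 ^ m * C * (sDev R0 v ^ 2 + (NF + NG) ^ 2) * (R ^ min (min α 1) κ) ^ 2 := by ring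
      _ ≤ _ := by gcongr
  · have hy' : 0 < ‖y‖ := norm_pos_iff.2 hy0
    calc ‖F y‖ ≤ NF * ((ε + ‖y‖ ^ 2) * ‖y‖ ^ (σ - 2 * s)) :=
          (hFb y hy).trans (mul_le_mul_of_nonneg_left (rpow_mul_rpow_le hε hy' hs0) hNF)
      _ = (ε + ‖y‖ ^ 2) * (NF * ‖y‖ ^ (κ - 1)) := by
          rw [show κ - 1 = σ - 2 * s by rw [hκ]; ring]; ring
      _ ≤ _ := by gcongr; linarith
  · have hy' : 0 < ‖y‖ := norm_pos_iff.2 hy0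
    calc |G y| ≤ NG * ((ε + ‖y‖ ^ 2) * ‖y‖ ^ (σ - 1 - 2 * s)) :=
          (hGb y hy hy0).trans (mul_le_mul_of_nonneg_left (rpow_mul_rpow_le hε hy' hs0) hNG)
      _ = (ε + ‖y‖ ^ 2) * (NG * ‖y‖ ^ (κ - 1) / ‖y‖) := by
          rw [show σ - 1 - 2 * s = κ - 1 - 1 by rw [hκ]; ring, Real.rpow_sub_one hy'.ne']; ring
      _ ≤ _ := by gcongr; linarith
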